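/- arXiv:1706.01089 — 3 statements merged into one kernel-verified Lean document; each statement's English description precedes it below -/
import Mathlib

section
/- Let α > 0 be irrational and satisfy condition (*). Let a < b be reals and let h : ℝ → ℝ be continuous with h = 0 outside [a,b] and h > 0 on (a,b). Assume h is piecewise linear, i.e. there is a partition a = t₀ < t₁ < ⋯ < t_k = b such that h is affine on each interval [t_{i−1}, t_i]. Let u = (1,α)/√(1+α²), v = (−α,1)/√(1+α²), and let ω = ∑_{g∈ℤ²} h(⟨g,v⟩)·δ_{⟨g,u⟩} be the associated weighted Dirac comb on ℝ. Then ω is bounded distance equivalent to m·λ, where λ is Lebesgue measure on ℝ and m = ∫_a^b h(t) dt. -/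
open MeasureTheory

/-- The Gauss map `x ↦ 1/{x}`. -/
noncomputable def gaussMap (x : ℝ) : ℝ := (Int.fract x)⁻¹

/-- The partial quotients `a_n` of the continued fraction expansion of `α`. -/
noncomputable def cfA (α : ℝ) (n : ℕ) : ℤ := ⌊gaussMap^[n] α⌋

/-- The convergent denominators `q_n` of the continued fraction expansion of `α`:
`q₀ = 1`, `q₁ = a₁`, `q_{n+2} = a_{n+2} q_{n+1} + q_n`. -/
noncomputable def cfQ (α : ℝ) : ℕ → ℝ
  | 0 => 1
  | 1 => (cfA α 1 : ℝ)
  | (n + 2) => (cfA α (n + 2) : ℝ) * cfQ α (n + 1) + cfQ α n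

/-- Condition (*) from Grepstad–Larcher:
`∑_{ℓ=0}^m a_{ℓ+1} q_ℓ^{-1/2} ∑_{k=1}^{ℓ+1} a_k` is bounded uniformly in `m`. -/
def CondStar (α : ℝ) : Prop :=
  ∃ C > 0, ∀ m : ℕ,
    ∑ ℓ ∈ Finset.range (m + 1),
      ((cfA α (ℓ + 1) : ℝ) / Real.sqrt (cfQ α ℓ)) *
        ∑ k ∈ Finset.Icc 1 (ℓ + 1), (cfA α k : ℝ) < C

/-- Bounded distance equivalence of measures on `ℝ`. -/
def BddDistMeasures (μ ν : Measure ℝ) : Prop :=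
  ∃ C > 0, ∀ a b : ℝ, a < b →
    |(μ (Set.Icc a b)).toReal - (ν (Set.Icc a b)).toReal| < C

theorem gaussMap_iterate_irrational {α : ℝ} (hα : Irrational α) (n : ℕ) :
    Irrational (gaussMap^[n] α) := by
  induction n with
  | zero => simpa using hα
  | succ n ih =>
    rw [Function.iterate_succ_apply', gaussMap, irrational_inv_iff, Int.fract]
    exact ih.sub_intCast _

theorem gaussMap_iterate_eq (α : ℝ) (n : ℕ) :
    gaussMap^[n] α = cfA α n + (gaussMap^[n + 1] α)⁻¹ := by
  rw [Function.iterate_succ_apply', gaussMap, inv_inv, cfA]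
  exact (Int.floor_add_fract _).symm

theorem one_lt_gaussMap_iterate_succ {α : ℝ} (hα : Irrational α) (n : ℕ) :
    1 < gaussMap^[n + 1] α := by
  rw [Function.iterate_succ_apply', gaussMap]
  have h0 : Int.fract (gaussMap^[n] α) ≠ 0 := by
    rw [Int.fract]
    exact ((gaussMap_iterate_irrational hα n).sub_intCast _).ne_zero
  exact (one_lt_inv₀ (lt_of_le_of_ne (Int.fract_nonneg _) h0.symm)).2 (Int.fract_lt_one _)

theorem one_le_cfA_succ {α : ℝ} (hα : Irrational α) (n : ℕ) : 1 ≤ cfA α (n + 1) := by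
  rw [cfA, Int.le_floor]
  exact_mod_cast (one_lt_gaussMap_iterate_succ hα n).le

/-- Consecutive convergents, as integers, with the Möbius relation to the complete quotient. -/
theorem exists_convergents {α : ℝ} (hα : Irrational α) (n : ℕ) :
    ∃ p p' q q' : ℤ, (q : ℝ) = cfQ α n ∧ (q' : ℝ) = cfQ α (n + 1) ∧ 0 < q ∧ 0 < q' ∧
      |p' * q - p * q'| = 1 ∧
      α * (q' * gaussMap^[n + 2] α + q) = p' * gaussMap^[n + 2] α + p := by
  induction n with
  | zero =>
    have h0 := gaussMap_iterate_eq α 0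
    have h1 := gaussMap_iterate_eq α 1
    have g1 := one_lt_gaussMap_iterate_succ hα 0
    have g2 := one_lt_gaussMap_iterate_succ hα 1
    simp only [Function.iterate_zero, id_eq, zero_add, Nat.reduceAdd] at h0 h1 g1 g2 ⊢
    refine ⟨cfA α 0, cfA α 1 * cfA α 0 + 1, 1, cfA α 1, by simp [cfQ], by simp [cfQ], one_pos,
      one_le_cfA_succ hα 0, by simp [mul_comm], ?_⟩
    generalize gaussMap^[1] α = x at *
    generalize gaussMap^[2] α = y at *
    have hx : x * y = cfA α 1 * y + 1 := by
      rw [h1]; field_simp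
    have hα' : α * x = cfA α 0 * x + 1 := by
      linear_combination x * h0 + inv_mul_cancel₀ (zero_lt_one.trans g1).ne'
    push_cast
    linear_combination (-α + cfA α 0) * hx + y * hα'
  | succ n ih =>
    obtain ⟨p, p', q, q', hq, hq', hqp, hqp', hdet, hrel⟩ := ih
    have h1 := gaussMap_iterate_eq α (n + 2)
    have g2 := one_lt_gaussMap_iterate_succ hα (n + 2)
    have ha := one_le_cfA_succ hα (n + 1)
    refine ⟨p', cfA α (n + 2) * p' + p, q', cfA α (n + 2) * q' + q, hq', ?_, hqp', ?_, ?_, ?_⟩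
    · push_cast
      rw [hq, hq', cfQ]
    · positivity
    · rw [← hdet, ← abs_neg]
      congr 1
      ring
    · change α * (_ * gaussMap^[n + 3] α + _) = _ * gaussMap^[n + 3] α + _
      change gaussMap^[n + 2] α = _ + (gaussMap^[n + 3] α)⁻¹ at h1
      change 1 < gaussMap^[n + 3] α at g2
      generalize gaussMap^[n + 2] α = x at *
      generalize gaussMap^[n + 3] α = y at *
      have hx : x * y = cfA α (n + 2) * y + 1 := by
        rw [h1]; field_simp
      push_cast
      linear_combination (-α * q' + p') * hx + y * hrel

theorem cfQ_bounds {α : ℝ} (hα : Irrational α) (n : ℕ) :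
    1 ≤ cfQ α n ∧ cfQ α n ≤ cfQ α (n + 1) ∧ (n + 1 : ℝ) ≤ cfQ α (n + 1) := by
  have ha : ∀ n, (1 : ℝ) ≤ cfA α (n + 1) := fun n => by exact_mod_cast one_le_cfA_succ hα n
  induction n with
  | zero => simpa [cfQ] using ha 0
  | succ n ih =>
    obtain ⟨h1, h2, h3⟩ := ih
    have h4 : cfQ α (n + 1) + cfQ α n ≤ cfQ α (n + 1 + 1) := by
      rw [cfQ]
      nlinarith [ha (n + 1)]
    push_cast
    exact ⟨by linarith, by linarith, by linarith⟩

theorem cfQ_succ_le {α : ℝ} (hα : Irrational α) (n : ℕ) :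
    cfQ α (n + 1) ≤ 2 * cfA α (n + 1) * cfQ α n := by
  have ha : (1 : ℝ) ≤ cfA α (n + 1) := by exact_mod_cast one_le_cfA_succ hα n
  cases n with
  | zero =>
    simp only [zero_add] at ha
    simp only [cfQ, zero_add]
    linarith
  | succ n =>
    obtain ⟨h1, h2, -⟩ := cfQ_bounds hα n
    rw [cfQ]
    change 1 ≤ (cfA α (n + 2) : ℝ) at ha
    nlinarith [show n + 1 + 1 = n + 2 from rfl]

theorem one_div_le_abs_mul_sub_int {α : ℝ} (hα : Irrational α) (n k : ℕ) (hk : 0 < k)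
    (hkn : 2 * (k : ℝ) ≤ cfQ α (n + 1)) (r : ℤ) :
    1 / (2 * cfQ α (n + 1)) ≤ |k * α - r| := by
  obtain ⟨p, p', q, q', hq, hq', hqp, hqp', hdet, hrel⟩ := exists_convergents hα n
  rw [← hq'] at hkn ⊢
  have g2 := one_lt_gaussMap_iterate_succ hα (n + 1)
  change 1 < gaussMap^[n + 2] α at g2
  generalize gaussMap^[n + 2] α = x at *
  have hQ : (0 : ℝ) < q := by exact_mod_cast hqp
  have hQ' : (0 : ℝ) < q' := by exact_mod_cast hqp'
  have hdetR : |(p' * q - p * q' : ℝ)| = 1 := by exact_mod_cast hdet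
  have happrox : |q' * α - p'| * q' ≤ 1 := by
    have h1 : (q' * α - p') * (q' * x + q) = -(p' * q - p * q') := by
      linear_combination (q' : ℝ) * hrel
    have hpos : (0 : ℝ) < q' * x + q := by positivity
    have h2 : |q' * α - p'| * (q' * x + q) = 1 := by
      rw [← hdetR, ← abs_neg (p' * q - p * q' : ℝ), ← h1, abs_mul, abs_of_pos hpos]
    rw [← h2]
    gcongr
    nlinarith
  have hne : (k : ℤ) * p' - r * q' ≠ 0 := by
    intro h0
    have hcop : IsCoprime q' p' := by
      rcases eq_or_eq_neg_of_abs_eq hdet with h | h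
      · exact ⟨-p, q, by linarith⟩
      · exact ⟨p, -q, by linarith⟩
    have hdvd : q' ∣ k * p' := ⟨r, by linarith⟩
    have hle := Int.le_of_dvd (by exact_mod_cast hk) (hcop.dvd_of_dvd_mul_right hdvd)
    have : (q' : ℝ) ≤ k := by exact_mod_cast hle
    have : (0 : ℝ) < k := by exact_mod_cast hk
    linarith
  have hone : (1 : ℝ) ≤ |(k : ℝ) * p' - r * q'| := by exact_mod_cast Int.one_le_abs hne
  have key : (1 : ℝ) / 2 ≤ |k * α - r| * q' := by
    have e : (k : ℝ) * p' - r * q' = (k * α - r) * q' - k * (q' * α - p') := by ring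
    have t := abs_sub ((k * α - r) * q') (k * (q' * α - p'))
    rw [← e, abs_mul, abs_mul, abs_of_pos hQ', Nat.abs_cast] at t
    have : (k : ℝ) * |q' * α - p'| ≤ 1 / 2 := by
      nlinarith [abs_nonneg (q' * α - p')]
    linarith
  rw [div_le_iff₀ (by positivity)]
  linarith

theorem sq_cfA_le {α : ℝ} (hα : Irrational α) (hstar : CondStar α) :
    ∃ C > 0, ∀ n, (cfA α (n + 1) : ℝ) ^ 2 ≤ C * √(cfQ α n) := by
  obtain ⟨C, hC, h⟩ := hstar
  have ha : ∀ n, (0 : ℝ) ≤ cfA α (n + 1) := fun n => by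
    exact_mod_cast zero_le_one.trans (one_le_cfA_succ hα n)
  have ha' : ∀ k, 1 ≤ k → (0 : ℝ) ≤ cfA α k := fun k hk => by
    obtain ⟨j, rfl⟩ := Nat.exists_eq_add_of_le' hk
    exact ha j
  refine ⟨C, hC, fun n => ?_⟩
  have hq : 0 < √(cfQ α n) := Real.sqrt_pos.2 (one_pos.trans_le (cfQ_bounds hα n).1)
  have h1 : (cfA α (n + 1) : ℝ) ≤ ∑ k ∈ Finset.Icc 1 (n + 1), (cfA α k : ℝ) :=
    Finset.single_le_sum (f := fun k => (cfA α k : ℝ))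
      (fun k hk => ha' k (Finset.mem_Icc.1 hk).1) (by simp)
  have h2 : (cfA α (n + 1) : ℝ) / √(cfQ α n) * ∑ k ∈ Finset.Icc 1 (n + 1), (cfA α k : ℝ) < C :=
    (Finset.single_le_sum
      (f := fun l => (cfA α (l + 1) : ℝ) / √(cfQ α l) * ∑ k ∈ Finset.Icc 1 (l + 1), (cfA α k : ℝ))
      (fun l _ => mul_nonneg (div_nonneg (ha l) (Real.sqrt_nonneg _))
        (Finset.sum_nonneg fun k hk => ha' k (Finset.mem_Icc.1 hk).1))
      (Finset.self_mem_range_succ n)).trans_lt (h n)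
  have h3 : (cfA α (n + 1) : ℝ) / √(cfQ α n) * cfA α (n + 1) ≤ C :=
    (mul_le_mul_of_nonneg_left h1 (div_nonneg (ha n) hq.le)).trans h2.le
  rw [div_mul_eq_mul_div, div_le_iff₀ hq] at h3
  rwa [sq]

/-- Under condition (*), `‖kα‖` is at least a constant times `k ^ (-5/4)`. -/
theorem exists_diophantine {α : ℝ} (hα : Irrational α) (hstar : CondStar α) :
    ∃ c > 0, ∀ k : ℕ, 0 < k → ∀ t : ℝ, 0 < t → (k : ℝ) ≤ t ^ 4 → ∀ r : ℤ,
      c / t ^ 5 ≤ |k * α - r| := by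
  obtain ⟨C, hC, hA⟩ := sq_cfA_le hα hstar
  refine ⟨1 / (2 * √(32 * C)), by positivity, fun k hk t ht hkt r => ?_⟩
  have hex : ∃ n, 2 * (k : ℝ) ≤ cfQ α (n + 1) := by
    refine ⟨2 * k, le_trans ?_ (cfQ_bounds hα (2 * k)).2.2⟩
    push_cast
    linarith
  classical
  obtain ⟨n, hn, hmin⟩ : ∃ n, 2 * (k : ℝ) ≤ cfQ α (n + 1) ∧ cfQ α n ≤ 2 * k := by
    refine ⟨Nat.find hex, Nat.find_spec hex, ?_⟩
    rcases hm : Nat.find hex with _ | m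
    · have : (1 : ℝ) ≤ k := by exact_mod_cast hk
      simp only [cfQ]
      linarith
    · have := Nat.find_min hex (m := m) (by omega)
      exact (not_le.1 this).le
  refine le_trans ?_ (one_div_le_abs_mul_sub_int hα n k hk hn r)
  have hq1 := (cfQ_bounds hα n).1
  have hQ1 := (cfQ_bounds hα (n + 1)).1
  rw [div_div]
  apply one_div_le_one_div_of_le (by positivity)
  rw [mul_assoc]
  gcongr
  have hsq : √(cfQ α n) ≤ 2 * t ^ 2 := by
    rw [Real.sqrt_le_left (by positivity)]
    nlinarith [sq_nonneg (t ^ 2)]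
  apply le_of_sq_le_sq _ (by positivity)
  rw [mul_pow, Real.sq_sqrt (by positivity)]
  have hsucc := cfQ_succ_le hα n
  calc cfQ α (n + 1) ^ 2 ≤ (2 * cfA α (n + 1) * cfQ α n) ^ 2 := by gcongr
    _ = 4 * (cfA α (n + 1) : ℝ) ^ 2 * cfQ α n ^ 2 := by ring
    _ ≤ 4 * (C * (2 * t ^ 2)) * (2 * t ^ 4) ^ 2 := by
      gcongr
      · exact (hA n).trans (by gcongr)
      · linarith
    _ = 32 * C * (t ^ 5) ^ 2 := by ring

theorem eval_bernoulli_two (x : ℝ) :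
    ((Polynomial.bernoulli 2).map (algebraMap ℚ ℝ)).eval x = x ^ 2 - x + 1 / 6 := by
  simp only [Polynomial.bernoulli, Finset.sum_range_succ, _root_.bernoulli_one, bernoulli_two,
    _root_.bernoulli_zero]
  norm_num
  ring

theorem two_mul_le_abs_sin_pi_mul (y : ℝ) : 2 * |y - round y| ≤ |Real.sin (Real.pi * y)| := by
  have h1 : |Real.sin (Real.pi * y)| = |Real.sin (Real.pi * (y - round y))| := by
    rw [mul_sub, mul_comm Real.pi (round y : ℝ), Real.sin_sub_int_mul_pi, abs_mul, abs_zpow,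
      abs_neg, abs_one, one_zpow, one_mul]
  have h2 : |Real.sin (Real.pi * (y - round y))| = |Real.sin (Real.pi * |y - round y|)| := by
    rcases abs_choice (y - round y) with h | h <;> rw [h]
    rw [mul_neg, Real.sin_neg, abs_neg]
  have hr := abs_sub_round y
  have hpi := Real.pi_pos
  have h3 := Real.mul_le_sin (x := Real.pi * |y - round y|) (by positivity) (by nlinarith)
  rw [h1, h2]
  refine le_trans (le_of_eq ?_) (h3.trans (le_abs_self _))
  field_simp

theorem abs_sum_cos_le (y θ : ℝ) (N : ℕ) (hθ : Real.sin (Real.pi * θ) ≠ 0) :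
    |∑ m ∈ Finset.range N, Real.cos (y + 2 * Real.pi * (m * θ))| ≤
      1 / |Real.sin (Real.pi * θ)| := by
  have key : 2 * Real.sin (Real.pi * θ) *
      ∑ m ∈ Finset.range N, Real.cos (y + 2 * Real.pi * (m * θ)) =
      Real.sin (y + 2 * Real.pi * (N * θ) - Real.pi * θ) - Real.sin (y - Real.pi * θ) := by
    induction N with
    | zero => simp
    | succ N ih =>
      rw [Finset.sum_range_succ, mul_add, ih]
      have e : y + 2 * Real.pi * ((N + 1 : ℕ) * θ) - Real.pi * θ =
          (y + 2 * Real.pi * (N * θ)) + Real.pi * θ := by push_cast; ring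
      rw [e, Real.sin_add, Real.sin_sub]
      ring
  rw [le_div_iff₀ (abs_pos.2 hθ)]
  have h1 := congrArg abs key
  rw [abs_mul, abs_mul, abs_two] at h1
  have h2 := abs_sub (Real.sin (y + 2 * Real.pi * (N * θ) - Real.pi * θ))
    (Real.sin (y - Real.pi * θ))
  have h3 := Real.abs_sin_le_one (y + 2 * Real.pi * (N * θ) - Real.pi * θ)
  have h4 := Real.abs_sin_le_one (y - Real.pi * θ)
  linarith

theorem sum_inv_sq_le_of_separated {ι : Type*} (s : Finset ι) (r : ι → ℝ) {δ : ℝ} (hδ : 0 < δ)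
    (hr : ∀ i ∈ s, δ ≤ |r i|) (hsep : ∀ i ∈ s, ∀ j ∈ s, i ≠ j → δ ≤ |r i - r j|) :
    ∑ i ∈ s, (1 / |r i|) ^ 2 ≤ 4 * (∑' n : ℤ, 1 / (n : ℝ) ^ 2) / δ ^ 2 := by
  have hinj : Set.InjOn (fun i => ⌊r i / δ⌋) s := by
    intro i hi j hj hij
    by_contra hne
    have h1 := Int.abs_sub_lt_one_of_floor_eq_floor hij
    rw [← sub_div, abs_div, abs_of_pos hδ, div_lt_one hδ] at h1
    exact (hsep i hi j hj hne).not_gt h1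
  have hterm : ∀ i ∈ s, (1 / |r i|) ^ 2 ≤ 4 / δ ^ 2 * (1 / (⌊r i / δ⌋ : ℝ) ^ 2) := by
    intro i hi
    have h0 := hr i hi
    have hpos := hδ.trans_le h0
    have hne : (⌊r i / δ⌋ : ℝ) ≠ 0 := by
      intro h
      have h' : ⌊r i / δ⌋ = 0 := by exact_mod_cast h
      rw [Int.floor_eq_zero_iff, Set.mem_Ico, le_div_iff₀ hδ, div_lt_one hδ, zero_mul] at h'
      rw [abs_of_nonneg h'.1] at h0
      linarith
    have hle : |(⌊r i / δ⌋ : ℝ)| * δ ≤ 2 * |r i| := by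
      have f1 := Int.floor_le (r i / δ)
      have f2 := Int.lt_floor_add_one (r i / δ)
      have e : r i = r i / δ * δ := by field_simp
      have f3 : |(⌊r i / δ⌋ : ℝ)| ≤ |r i / δ| + 1 := by
        rw [abs_le]
        constructor <;> linarith [neg_abs_le (r i / δ), le_abs_self (r i / δ)]
      rw [abs_div, abs_of_pos hδ] at f3
      calc |(⌊r i / δ⌋ : ℝ)| * δ ≤ (|r i| / δ + 1) * δ := by gcongr
        _ = |r i| + δ := by field_simp
        _ ≤ 2 * |r i| := by linarith
    have hsq : (⌊r i / δ⌋ : ℝ) ^ 2 * δ ^ 2 ≤ 4 * |r i| ^ 2 := by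
      rw [← sq_abs (⌊r i / δ⌋ : ℝ)]
      nlinarith [mul_nonneg (abs_nonneg (⌊r i / δ⌋ : ℝ)) hδ.le]
    rw [div_pow, one_pow, div_mul_div_comm, mul_one, div_le_div_iff₀ (by positivity) (by positivity)]
    linarith
  calc ∑ i ∈ s, (1 / |r i|) ^ 2 ≤ ∑ i ∈ s, 4 / δ ^ 2 * (1 / (⌊r i / δ⌋ : ℝ) ^ 2) :=
        Finset.sum_le_sum hterm
    _ = 4 / δ ^ 2 * ∑ n ∈ s.image (fun i => ⌊r i / δ⌋), 1 / (n : ℝ) ^ 2 := by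
      rw [Finset.sum_image hinj, Finset.mul_sum]
    _ ≤ 4 / δ ^ 2 * ∑' n : ℤ, 1 / (n : ℝ) ^ 2 := by
      gcongr
      exact (Real.summable_one_div_int_pow.2 one_lt_two).sum_le_tsum _ fun _ _ => by positivity
    _ = 4 * (∑' n : ℤ, 1 / (n : ℝ) ^ 2) / δ ^ 2 := by ring

theorem summable_inv_sq_mul_inv_dist {α c : ℝ} (hc : 0 < c)
    (hdio : ∀ k : ℕ, 0 < k → ∀ t : ℝ, 0 < t → (k : ℝ) ≤ t ^ 4 → ∀ r : ℤ,
      c / t ^ 5 ≤ |k * α - r|) :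
    Summable fun n : ℕ => 1 / (n : ℝ) ^ 2 * (1 / |n * α - round (n * α)|) := by
  set f : ℕ → ℝ := fun n => 1 / (n : ℝ) ^ 2 * (1 / |n * α - round (n * α)|) with hf
  have hf0 : ∀ n, 0 ≤ f n := fun n => by positivity
  obtain ⟨ρ, hρ1, hρ4⟩ : ∃ ρ : ℝ, 1 < ρ ∧ ρ ^ 4 = 2 := by
    have h4 : ((2 : ℝ) ^ (1 / 4 : ℝ)) ^ 4 = 2 := by
      rw [← Real.rpow_natCast, ← Real.rpow_mul (by norm_num)]
      norm_num
    exact ⟨2 ^ (1 / 4 : ℝ), Real.one_lt_rpow (by norm_num) (by norm_num), h4⟩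
  have hρ : 0 < ρ := by linarith
  set Z : ℝ := 4 * ∑' n : ℤ, 1 / (n : ℝ) ^ 2 with hZ
  have hZ0 : 0 ≤ Z := mul_nonneg (by norm_num) (tsum_nonneg fun n => by positivity)
  set D : ℝ := √Z * ρ ^ 5 / c with hD
  have hpow : ∀ j : ℕ, (2 : ℝ) ^ j = (ρ ^ j) ^ 4 := fun j => by rw [← hρ4]; ring
  have hblock : ∀ j : ℕ, ∑ k ∈ Finset.Ico (2 ^ j) (2 ^ (j + 1)), f k ≤ D * (1 / ρ) ^ j := by
    intro j
    set δ : ℝ := c / (ρ ^ (j + 1)) ^ 5 with hδ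
    have hδ0 : 0 < δ := by positivity
    have hlow : ∀ k : ℕ, 0 < k → k < 2 ^ (j + 1) → ∀ r : ℤ, δ ≤ |k * α - r| := by
      intro k hk hk2 r
      refine hdio k hk _ (by positivity) ?_ r
      rw [← hpow]
      exact_mod_cast hk2.le
    have hsum := sum_inv_sq_le_of_separated (Finset.Ico (2 ^ j) (2 ^ (j + 1)))
      (fun k : ℕ => k * α - round (k * α)) hδ0
      (fun k hk => by
        rw [Finset.mem_Ico] at hk
        exact hlow k (lt_of_lt_of_le (by positivity) hk.1) hk.2 _)
      (by
        have main : ∀ k l : ℕ, k < 2 ^ (j + 1) → l < k →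
            δ ≤ |(k * α - round (k * α)) - (l * α - round (l * α))| := by
          intro k l hk hlk
          have := hlow (k - l) (by omega) (by omega) (round (k * α) - round (l * α))
          rw [Nat.cast_sub hlk.le] at this
          convert this using 2
          push_cast
          ring
        intro k hk l hl hne
        rw [Finset.mem_Ico] at hk hl
        rcases lt_or_gt_of_ne hne with h | h
        · rw [abs_sub_comm]
          exact main l k hl.2 h
        · exact main k l hk.2 h)
    have hcs := sq_sum_le_card_mul_sum_sq (s := Finset.Ico (2 ^ j) (2 ^ (j + 1)))
      (f := fun k : ℕ => 1 / |k * α - round (k * α)|)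
    have hcard : ((Finset.Ico (2 ^ j) (2 ^ (j + 1))).card : ℝ) = (ρ ^ j) ^ 4 := by
      rw [Nat.card_Ico, pow_succ, Nat.mul_two, Nat.add_sub_cancel]
      push_cast
      exact hpow j
    have hL1 : ∑ k ∈ Finset.Ico (2 ^ j) (2 ^ (j + 1)), 1 / |(k : ℕ) * α - round (k * α)| ≤
        (ρ ^ j) ^ 2 * √Z / δ := by
      apply le_of_sq_le_sq _ (by positivity)
      refine hcs.trans ?_
      rw [hcard, div_pow, mul_pow, Real.sq_sqrt hZ0, ← pow_mul (ρ ^ j) 2 2, mul_div_assoc]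
      gcongr
    calc ∑ k ∈ Finset.Ico (2 ^ j) (2 ^ (j + 1)), f k
        ≤ ∑ k ∈ Finset.Ico (2 ^ j) (2 ^ (j + 1)),
            1 / ((ρ ^ j) ^ 4) ^ 2 * (1 / |(k : ℕ) * α - round (k * α)|) := by
          refine Finset.sum_le_sum fun k hk => ?_
          rw [Finset.mem_Ico] at hk
          have : (ρ ^ j) ^ 4 ≤ k := by
            rw [← hpow]
            exact_mod_cast hk.1
          simp only [hf]
          gcongr
      _ ≤ 1 / ((ρ ^ j) ^ 4) ^ 2 * ((ρ ^ j) ^ 2 * √Z / δ) := by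
          rw [← Finset.mul_sum]
          gcongr
      _ = D * (1 / ρ) ^ j := by
          rw [hδ, hD, one_div_pow]
          field_simp
          ring
  have hpart : ∀ J : ℕ, ∑ k ∈ Finset.range (2 ^ J), f k ≤ f 0 + D * ∑ j ∈ Finset.range J, (1 / ρ) ^ j := by
    intro J
    induction J with
    | zero => simp
    | succ J ih =>
      rw [← Finset.sum_range_add_sum_Ico f (Nat.pow_le_pow_right two_pos J.le_succ),
        Finset.sum_range_succ]
      linarith [hblock J]
  have hD0 : 0 ≤ D := by positivity
  have hgeom := summable_geometric_of_lt_one (r := 1 / ρ) (by positivity)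
    ((div_lt_one hρ).2 hρ1)
  refine summable_of_sum_range_le (c := f 0 + D * ∑' j : ℕ, (1 / ρ) ^ j) hf0 fun n => ?_
  calc ∑ k ∈ Finset.range n, f k ≤ ∑ k ∈ Finset.range (2 ^ n), f k :=
        Finset.sum_le_sum_of_subset_of_nonneg
          (Finset.range_mono Nat.lt_two_pow_self.le) fun k _ _ => hf0 k
    _ ≤ _ := (hpart n).trans (by
        gcongr
        exact hgeom.sum_le_tsum _ fun _ _ => by positivity)

/-- The periodic Bernoulli function `B₂({x})`. -/
noncomputable def periodicBernoulliTwo (x : ℝ) : ℝ := Int.fract x ^ 2 - Int.fract x + 1 / 6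

theorem hasSum_periodicBernoulliTwo (x : ℝ) :
    HasSum (fun n : ℕ => 1 / (n : ℝ) ^ 2 * Real.cos (2 * Real.pi * n * x))
      (Real.pi ^ 2 * periodicBernoulliTwo x) := by
  have h := hasSum_one_div_nat_pow_mul_cos one_ne_zero
    (x := Int.fract x) ⟨Int.fract_nonneg x, (Int.fract_lt_one x).le⟩
  rw [mul_one, eval_bernoulli_two] at h
  convert h using 1
  · ext n
    congr 1
    rw [Int.fract, show 2 * Real.pi * n * (x - ⌊x⌋) =
      2 * Real.pi * n * x - ((n * ⌊x⌋ : ℤ) : ℝ) * (2 * Real.pi) by push_cast; ring,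
      Real.cos_sub_int_mul_two_pi]
  · rw [periodicBernoulliTwo]
    simp only [Nat.factorial]
    push_cast
    ring

/-- Birkhoff sums of `B₂({x})` under the rotation by `α` are uniformly bounded. -/
theorem exists_abs_sum_periodicBernoulliTwo_le {α c : ℝ} (hα : Irrational α) (hc : 0 < c)
    (hdio : ∀ k : ℕ, 0 < k → ∀ t : ℝ, 0 < t → (k : ℝ) ≤ t ^ 4 → ∀ r : ℤ,
      c / t ^ 5 ≤ |k * α - r|) :
    ∃ C, ∀ (x : ℝ) (N : ℕ), |∑ m ∈ Finset.range N, periodicBernoulliTwo (x + m * α)| ≤ C := by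
  have hS := summable_inv_sq_mul_inv_dist hc hdio
  refine ⟨(∑' n : ℕ, 1 / (n : ℝ) ^ 2 * (1 / |n * α - round (n * α)|)) / Real.pi ^ 2,
    fun x N => ?_⟩
  have h1 := hasSum_sum (s := Finset.range N) fun m _ => hasSum_periodicBernoulliTwo (x + m * α)
  simp only [← Finset.mul_sum] at h1
  have h2 := h1.norm_le_of_bounded hS.hasSum (fun n => ?_)
  · rw [Real.norm_eq_abs, abs_mul, abs_of_pos (by positivity : 0 < Real.pi ^ 2)] at h2
    rw [le_div_iff₀ (by positivity)]
    linarith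
  · rw [Real.norm_eq_abs, abs_mul, abs_of_nonneg (by positivity : (0 : ℝ) ≤ 1 / (n : ℝ) ^ 2)]
    rcases Nat.eq_zero_or_pos n with rfl | hn
    · simp
    gcongr
    have hne : (n * α - round (n * α) : ℝ) ≠ 0 :=
      ((hα.natCast_mul hn.ne').sub_intCast _).ne_zero
    have hpos := abs_pos.2 hne
    have hsin := two_mul_le_abs_sin_pi_mul (n * α)
    have hcos := abs_sum_cos_le (2 * Real.pi * n * x) (n * α) N
      (abs_pos.1 (lt_of_lt_of_le (by positivity) hsin))
    refine le_trans (le_of_eq ?_) (hcos.trans (one_div_le_one_div_of_le hpos (by linarith)))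
    congr 1
    refine Finset.sum_congr rfl fun m _ => ?_
    congr 1
    ring

theorem sum_Icc_posPart_sub {y : ℝ} {l L : ℤ} (hl : l ≤ ⌊y⌋) (hL : ⌊y⌋ ≤ L) :
    ∑ n ∈ Finset.Icc l L, max ((n : ℝ) - y) 0 =
      (((L : ℝ) - y) ^ 2 + (L - y) + 1 / 6 - periodicBernoulliTwo y) / 2 := by
  induction L, hL using Int.leInduction with
  | base =>
    rw [Finset.sum_eq_zero, periodicBernoulliTwo, Int.fract]
    · ring
    · intro n hn
      have h1 : (n : ℝ) ≤ ⌊y⌋ := by exact_mod_cast (Finset.mem_Icc.1 hn).2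
      exact max_eq_right (by linarith [Int.floor_le y])
  | succ L hL ih =>
    have h1 : (⌊y⌋ : ℝ) ≤ L := by exact_mod_cast hL
    rw [← Finset.insert_Icc_right_eq_Icc_add_one (by omega), Finset.sum_insert (by simp), ih]
    push_cast
    rw [max_eq_left (by linarith [Int.lt_floor_add_one y])]
    ring

theorem integral_posPart_sub {a b t : ℝ} (hat : a ≤ t) (htb : t ≤ b) :
    ∫ x in a..b, max (x - t) 0 = (b - t) ^ 2 / 2 := by
  have hc : Continuous fun x : ℝ => max (x - t) 0 := by fun_prop
  rw [← intervalIntegral.integral_add_adjacent_intervals (b := t)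
    (hc.intervalIntegrable _ _) (hc.intervalIntegrable _ _),
    intervalIntegral.integral_congr (g := fun _ => (0 : ℝ)) (a := a),
    intervalIntegral.integral_congr (g := fun x => x - t) (b := b)]
  · simp
    ring
  · intro x hx
    rw [Set.uIcc_of_le htb] at hx
    exact max_eq_left (by linarith [hx.1])
  · intro x hx
    rw [Set.uIcc_of_le hat] at hx
    exact max_eq_right (by linarith [hx.2])

theorem exists_sum_posPart_extend {h : ℝ → ℝ} {t c : ℕ → ℝ} {n : ℕ} {s : Set ℝ} {p q : ℝ}
    (hc : ∀ x ≤ t n, h x = ∑ j ∈ Finset.range n, c j * max (x - t j) 0)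
    (ht : ∀ j < n, t j ≤ t n) (hts : t n ∈ s)
    (hpq : ∀ x ∈ s, h x = p * x + q) :
    ∃ c' : ℕ → ℝ, ∀ x, x ≤ t n ∨ x ∈ s →
      h x = ∑ j ∈ Finset.range (n + 1), c' j * max (x - t j) 0 := by
  refine ⟨Function.update c n (p - ∑ j ∈ Finset.range n, c j), fun x hx => ?_⟩
  rw [Finset.sum_range_succ, Function.update_self, Finset.sum_congr rfl
    (g := fun j => c j * max (x - t j) 0) fun j hj => by
      rw [Function.update_of_ne (Finset.mem_range.1 hj).ne]]
  have hlin : ∀ x, t n ≤ x → ∑ j ∈ Finset.range n, c j * max (x - t j) 0 =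
      (∑ j ∈ Finset.range n, c j) * x - ∑ j ∈ Finset.range n, c j * t j := by
    intro x hx
    rw [Finset.sum_mul, ← Finset.sum_sub_distrib]
    refine Finset.sum_congr rfl fun j hj => ?_
    rw [max_eq_left (by linarith [ht j (Finset.mem_range.1 hj)])]
    ring
  rcases le_or_gt x (t n) with hle | hgt
  · rw [hc x hle, max_eq_right (by linarith)]
    ring
  · have hxs := hx.resolve_left hgt.not_ge
    have h1 := hc _ le_rfl
    rw [hlin _ le_rfl, hpq _ hts] at h1
    rw [hlin x hgt.le, max_eq_left (by linarith), hpq x hxs]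
    linear_combination h1

theorem exists_eq_sum_posPart {h : ℝ → ℝ} {k : ℕ} {t : ℕ → ℝ}
    (ht : ∀ j n, j ≤ n → n ≤ k → t j ≤ t n)
    (hleft : ∀ x ≤ t 0, h x = 0) (hright : ∀ x, t k ≤ x → h x = 0)
    (haff : ∀ i < k, ∃ p q : ℝ, ∀ x ∈ Set.Icc (t i) (t (i + 1)), h x = p * x + q) :
    ∃ c : ℕ → ℝ, (∀ x, h x = ∑ j ∈ Finset.range (k + 1), c j * max (x - t j) 0) ∧
      ∑ j ∈ Finset.range (k + 1), c j = 0 ∧ ∑ j ∈ Finset.range (k + 1), c j * t j = 0 := by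
  have hstep : ∀ n ≤ k, ∃ c : ℕ → ℝ, ∀ x ≤ t n,
      h x = ∑ j ∈ Finset.range n, c j * max (x - t j) 0 := by
    intro n
    induction n with
    | zero => exact fun _ => ⟨0, fun x hx => by simpa using hleft x hx⟩
    | succ n ih =>
      intro hn
      obtain ⟨c, hc⟩ := ih (by omega)
      obtain ⟨p, q, hpq⟩ := haff n (by omega)
      obtain ⟨c', hc'⟩ := exists_sum_posPart_extend
        (s := Set.Icc (t n) (t (n + 1))) hc (fun j hj => ht j n hj.le (by omega)) ⟨le_rfl, ht n (n + 1) (by omega) hn⟩ hpq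
      exact ⟨c', fun x hx => hc' x ((le_total x (t n)).imp_right fun h1 => ⟨h1, hx⟩)⟩
  obtain ⟨c, hc⟩ := hstep k le_rfl
  obtain ⟨c', hc'⟩ := exists_sum_posPart_extend (s := Set.Ici (t k)) (p := 0) (q := 0) hc
    (fun j hj => ht j k hj.le le_rfl) Set.self_mem_Ici
    (fun x hx => by simpa using hright x hx)
  have hlin : ∀ x, t k ≤ x →
      (∑ j ∈ Finset.range (k + 1), c' j) * x - ∑ j ∈ Finset.range (k + 1), c' j * t j = 0 := by
    intro x hx
    rw [← hright x hx, hc' x (Or.inr hx), Finset.sum_mul, ← Finset.sum_sub_distrib]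
    refine Finset.sum_congr rfl fun j hj => ?_
    rw [max_eq_left (by linarith [ht j k (Finset.mem_range_succ_iff.1 hj) le_rfl])]
    ring
  have h1 := hlin (t k) le_rfl
  have h2 := hlin (t k + 1) (by linarith)
  have h3 : ∑ j ∈ Finset.range (k + 1), c' j = 0 := by linarith
  rw [h3] at h1
  exact ⟨c', fun x => hc' x (le_total x (t k)), h3, by linarith⟩

section

variable {h : ℝ → ℝ} {ι : Type*} {J : Finset ι} {c t : ι → ℝ} {a b : ℝ}

theorem integral_eq_of_eq_sum_posPart (hh : ∀ x, h x = ∑ j ∈ J, c j * max (x - t j) 0)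
    (hc : ∑ j ∈ J, c j = 0) (hct : ∑ j ∈ J, c j * t j = 0)
    (hta : ∀ j ∈ J, a ≤ t j) (htb : ∀ j ∈ J, t j ≤ b) :
    ∫ x in a..b, h x = (∑ j ∈ J, c j * t j ^ 2) / 2 := by
  simp only [hh]
  rw [intervalIntegral.integral_finsetSum fun j _ =>
    Continuous.intervalIntegrable (by fun_prop) _ _]
  calc ∑ j ∈ J, ∫ x in a..b, c j * max (x - t j) 0
      = ∑ j ∈ J, (b ^ 2 / 2 * c j - b * (c j * t j) + c j * t j ^ 2 / 2) := by
        refine Finset.sum_congr rfl fun j hj => ?_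
        rw [intervalIntegral.integral_const_mul, integral_posPart_sub (hta j hj) (htb j hj)]
        ring
    _ = _ := by
        rw [Finset.sum_add_distrib, Finset.sum_sub_distrib, ← Finset.mul_sum, ← Finset.mul_sum,
          hc, hct, Finset.sum_div]
        ring

theorem sum_Icc_eq_of_eq_sum_posPart (hh : ∀ x, h x = ∑ j ∈ J, c j * max (x - t j) 0)
    (hc : ∑ j ∈ J, c j = 0) (hct : ∑ j ∈ J, c j * t j = 0)
    (hta : ∀ j ∈ J, a ≤ t j) (htb : ∀ j ∈ J, t j ≤ b) {s : ℝ} (hs : 0 < s) (x : ℝ) :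
    ∑ n ∈ Finset.Icc ⌊x + s * a⌋ ⌊x + s * b⌋, h ((n - x) / s) =
      s * (∫ x in a..b, h x) - (∑ j ∈ J, c j * periodicBernoulliTwo (x + s * t j)) / (2 * s) := by
  rw [integral_eq_of_eq_sum_posPart hh hc hct hta htb]
  set L := ⌊x + s * b⌋
  have hterm : ∀ n : ℤ, h ((n - x) / s) =
      ∑ j ∈ J, c j / s * max ((n : ℝ) - (x + s * t j)) 0 := by
    intro n
    rw [hh]
    refine Finset.sum_congr rfl fun j _ => ?_
    rw [show (n - x) / s - t j = (n - (x + s * t j)) / s by field_simp; ring,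
      ← zero_div s, max_div_div_right hs.le]
    simp only [zero_div]
    ring
  simp only [hterm]
  rw [Finset.sum_comm]
  calc _ = ∑ j ∈ J, ((((L : ℝ) - x) ^ 2 + (L - x) + 1 / 6) / (2 * s) * c j
          - ((L : ℝ) - x + 1 / 2) * (c j * t j)
          + s * (c j * t j ^ 2) / 2
          - c j * periodicBernoulliTwo (x + s * t j) / (2 * s)) := by
        refine Finset.sum_congr rfl fun j hj => ?_
        rw [← Finset.mul_sum, sum_Icc_posPart_sub
          (Int.floor_mono (by have := hta j hj; gcongr)) (Int.floor_mono (by have := htb j hj; gcongr))]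
        field_simp
        ring
    _ = _ := by
        rw [Finset.sum_sub_distrib, Finset.sum_add_distrib, Finset.sum_sub_distrib,
          ← Finset.mul_sum, ← Finset.mul_sum, ← Finset.sum_div, ← Finset.sum_div,
          ← Finset.mul_sum, hc, hct]
        ring

theorem exists_abs_sum_Ico_sub_le (hh : ∀ x, h x = ∑ j ∈ J, c j * max (x - t j) 0)
    (hc : ∑ j ∈ J, c j = 0) (hct : ∑ j ∈ J, c j * t j = 0)
    (hta : ∀ j ∈ J, a ≤ t j) (htb : ∀ j ∈ J, t j ≤ b) {s : ℝ} (hs : 0 < s) {α : ℝ}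
    (hα : ∃ C, ∀ (x : ℝ) (N : ℕ),
      |∑ m ∈ Finset.range N, periodicBernoulliTwo (x + m * α)| ≤ C) :
    ∃ C, 0 ≤ C ∧ ∀ M N : ℤ, M ≤ N →
      |∑ m ∈ Finset.Ico M N,
          ∑ n ∈ Finset.Icc ⌊m * α + s * a⌋ ⌊m * α + s * b⌋, h ((n - m * α) / s) -
        (N - M) * (s * ∫ x in a..b, h x)| ≤ C := by
  obtain ⟨C, hC⟩ := hα
  have hC0 : 0 ≤ C := (abs_nonneg _).trans (hC 0 0)
  refine ⟨(∑ j ∈ J, |c j| * C) / (2 * s), by positivity, fun M N hMN => ?_⟩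
  obtain ⟨k, rfl⟩ := Int.le.dest hMN
  simp only [sum_Icc_eq_of_eq_sum_posPart hh hc hct hta htb hs]
  rw [Finset.sum_sub_distrib, Finset.sum_const, Int.card_Ico, add_sub_cancel_left, Int.toNat_natCast,
    ← Finset.sum_div, Finset.sum_comm, nsmul_eq_mul]
  push_cast
  rw [add_sub_cancel_left, sub_sub_cancel_left, abs_neg, abs_div, abs_of_pos (by positivity : 0 < 2 * s)]
  gcongr
  refine (Finset.abs_sum_le_sum_abs _ _).trans (Finset.sum_le_sum fun j _ => ?_)
  rw [← Finset.mul_sum, abs_mul]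
  gcongr
  have hshift : ∑ m ∈ Finset.Ico M (M + k), periodicBernoulliTwo (m * α + s * t j) =
      ∑ i ∈ Finset.range k, periodicBernoulliTwo ((M * α + s * t j) + i * α) := by
    symm
    refine Finset.sum_bij (fun i _ => M + i) ?_ ?_ ?_ ?_
    · intro i hi
      rw [Finset.mem_range] at hi
      rw [Finset.mem_Ico]
      omega
    · intro i _ j _ hij
      omega
    · intro m hm
      rw [Finset.mem_Ico] at hm
      exact ⟨(m - M).toNat, by rw [Finset.mem_range]; omega, by omega⟩
    · intro i _
      congr 1
      push_cast
      ring
  rw [hshift]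
  exact hC _ _

end

section

variable {h : ℝ → ℝ} {a b s α : ℝ}

theorem tsum_ofReal_fiber (hsupp : ∀ x ∉ Set.Icc a b, h x = 0) (h0 : ∀ x, 0 ≤ h x) (hs : 0 < s)
    (x : ℝ) : ∑' n : ℤ, ENNReal.ofReal (h ((n - x) / s)) =
      ENNReal.ofReal (∑ n ∈ Finset.Icc ⌊x + s * a⌋ ⌊x + s * b⌋, h ((n - x) / s)) := by
  rw [ENNReal.ofReal_sum_of_nonneg fun n _ => h0 _]
  refine tsum_eq_sum fun n hn => ?_
  rw [hsupp, ENNReal.ofReal_zero]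
  contrapose! hn
  obtain ⟨h1, h2⟩ := hn
  rw [le_div_iff₀ hs] at h1
  rw [div_le_iff₀ hs] at h2
  rw [Finset.mem_Icc]
  exact ⟨Int.floor_le_iff.2 (by linarith), Int.le_floor.2 (by linarith)⟩

/-- The Dirac comb with weights `h((n - mα)/s)` at `sm + α(n - mα)/s`; for `s = √(1 + α²)` this is
the comb `∑ h(⟨g,v⟩) δ_{⟨g,u⟩}`. -/
noncomputable def weightedComb (h : ℝ → ℝ) (α s : ℝ) : Measure ℝ :=
  Measure.sum fun g : ℤ × ℤ => ENNReal.ofReal (h ((g.2 - g.1 * α) / s)) •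
    Measure.dirac (s * g.1 + α * ((g.2 - g.1 * α) / s))

theorem weightedComb_Icc (A B : ℝ) : weightedComb h α s (Set.Icc A B) =
    ∑' (m : ℤ) (n : ℤ), ENNReal.ofReal (h ((n - m * α) / s)) *
      (Set.Icc A B).indicator 1 (s * m + α * ((n - m * α) / s)) := by
  rw [weightedComb, Measure.sum_apply _ measurableSet_Icc, ← ENNReal.tsum_prod]
  simp only [Measure.smul_apply, Measure.dirac_apply' _ measurableSet_Icc, smul_eq_mul]

theorem abs_mul_le_of_mem_Icc (hα : 0 < α) {x : ℝ} (hx : x ∈ Set.Icc a b) :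
    |α * x| ≤ α * (|a| + |b|) := by
  rw [abs_mul, abs_of_pos hα]
  gcongr
  rw [abs_le]
  constructor <;> linarith [hx.1, hx.2, neg_abs_le a, abs_nonneg a, abs_nonneg b, le_abs_self b]

theorem weightedComb_Icc_le (hsupp : ∀ x ∉ Set.Icc a b, h x = 0) (h0 : ∀ x, 0 ≤ h x)
    (hs : 0 < s) (hα : 0 < α) (A B : ℝ) :
    weightedComb h α s (Set.Icc A B) ≤ ENNReal.ofReal
      (∑ m ∈ Finset.Ico ⌈(A - α * (|a| + |b|)) / s⌉ (⌊(B + α * (|a| + |b|)) / s⌋ + 1),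
        ∑ n ∈ Finset.Icc ⌊m * α + s * a⌋ ⌊m * α + s * b⌋, h ((n - m * α) / s)) := by
  rw [ENNReal.ofReal_sum_of_nonneg fun m _ => Finset.sum_nonneg fun n _ => h0 _, weightedComb_Icc]
  simp only [← tsum_ofReal_fiber hsupp h0 hs]
  rw [tsum_eq_sum]
  · refine Finset.sum_le_sum fun m _ => ENNReal.tsum_le_tsum fun n => ?_
    refine mul_le_of_le_one_right' ?_
    exact Set.indicator_le_self' (by simp) _
  · intro m hm
    rw [ENNReal.tsum_eq_zero]
    intro n
    by_cases hx : (n - m * α) / s ∈ Set.Icc a b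
    · have hR := abs_le.1 (abs_mul_le_of_mem_Icc hα hx)
      rw [Set.indicator_of_notMem, mul_zero]
      contrapose! hm
      rw [Finset.mem_Ico, Int.lt_add_one_iff, Int.ceil_le, Int.le_floor, div_le_iff₀ hs,
        le_div_iff₀ hs]
      constructor <;> linarith [hm.1, hm.2]
    · rw [hsupp _ hx, ENNReal.ofReal_zero, zero_mul]

theorem le_weightedComb_Icc (hsupp : ∀ x ∉ Set.Icc a b, h x = 0) (h0 : ∀ x, 0 ≤ h x)
    (hs : 0 < s) (hα : 0 < α) (A B : ℝ) :
    ENNReal.ofReal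
      (∑ m ∈ Finset.Ico ⌈(A + α * (|a| + |b|)) / s⌉ (⌊(B - α * (|a| + |b|)) / s⌋ + 1),
        ∑ n ∈ Finset.Icc ⌊m * α + s * a⌋ ⌊m * α + s * b⌋, h ((n - m * α) / s)) ≤
      weightedComb h α s (Set.Icc A B) := by
  rw [ENNReal.ofReal_sum_of_nonneg fun m _ => Finset.sum_nonneg fun n _ => h0 _, weightedComb_Icc]
  simp only [← tsum_ofReal_fiber hsupp h0 hs]
  refine le_trans (Finset.sum_le_sum fun m hm => ENNReal.tsum_le_tsum fun n => ?_)
    (ENNReal.sum_le_tsum _)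
  rw [Finset.mem_Ico, Int.lt_add_one_iff, Int.ceil_le, Int.le_floor, div_le_iff₀ hs,
    le_div_iff₀ hs] at hm
  beta_reduce
  by_cases hx : (n - m * α) / s ∈ Set.Icc a b
  · have hR := abs_le.1 (abs_mul_le_of_mem_Icc hα hx)
    rw [Set.indicator_of_mem, Pi.one_apply, mul_one]
    constructor <;> linarith [hm.1, hm.2]
  · rw [hsupp _ hx, ENNReal.ofReal_zero]
    exact zero_le

theorem bddDistMeasures_weightedComb (hsupp : ∀ x ∉ Set.Icc a b, h x = 0) (h0 : ∀ x, 0 ≤ h x)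
    (hs : 0 < s) (hα : 0 < α) {I : ℝ} (hI : 0 ≤ I)
    (hsum : ∃ C, 0 ≤ C ∧ ∀ M N : ℤ, M ≤ N →
      |∑ m ∈ Finset.Ico M N,
          ∑ n ∈ Finset.Icc ⌊m * α + s * a⌋ ⌊m * α + s * b⌋, h ((n - m * α) / s) -
        (N - M) * (s * I)| ≤ C) :
    BddDistMeasures (weightedComb h α s) (ENNReal.ofReal I • (volume : Measure ℝ)) := by
  obtain ⟨C, hC0, hC⟩ := hsum
  set R := α * (|a| + |b|) with hR
  have hR0 : 0 ≤ R := by positivity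
  have hS0 : ∀ M N : ℤ, 0 ≤ ∑ m ∈ Finset.Ico M N,
      ∑ n ∈ Finset.Icc ⌊m * α + s * a⌋ ⌊m * α + s * b⌋, h ((n - m * α) / s) :=
    fun M N => Finset.sum_nonneg fun m _ => Finset.sum_nonneg fun n _ => h0 _
  refine ⟨C + I * (2 * R + s) + 1, by positivity, fun A B hAB => ?_⟩
  have hν : ((ENNReal.ofReal I • (volume : Measure ℝ)) (Set.Icc A B)).toReal = I * (B - A) := by
    rw [Measure.smul_apply, Real.volume_Icc, smul_eq_mul, ENNReal.toReal_mul,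
      ENNReal.toReal_ofReal hI, ENNReal.toReal_ofReal (by linarith)]
  have hup := weightedComb_Icc_le hsupp h0 hs hα A B
  have hlo := le_weightedComb_Icc hsupp h0 hs hα A B
  rw [← hR] at hup hlo
  have hfin := ne_top_of_le_ne_top ENNReal.ofReal_ne_top hup
  replace hup := ENNReal.toReal_le_of_le_ofReal (hS0 _ _) hup
  rw [ENNReal.ofReal_le_iff_le_toReal hfin] at hlo
  have hω0 : 0 ≤ (weightedComb h α s (Set.Icc A B)).toReal := ENNReal.toReal_nonneg
  rw [hν]
  have hsI : 0 ≤ s * I := by positivity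
  have hupper : (weightedComb h α s (Set.Icc A B)).toReal ≤ I * (B - A) + C + I * (2 * R + s) := by
    have hle : (A - R) / s ≤ (B + R) / s := by
      gcongr
      linarith
    have hMN : ⌈(A - R) / s⌉ ≤ ⌊(B + R) / s⌋ + 1 := by
      rw [Int.ceil_le]
      push_cast
      linarith [Int.lt_floor_add_one ((B + R) / s)]
    have h1 := (abs_le.1 (hC _ _ hMN)).2
    have h2 : (((⌊(B + R) / s⌋ + 1 : ℤ) : ℝ) - ⌈(A - R) / s⌉) * (s * I) ≤
        ((B + R) / s + 1 - (A - R) / s) * (s * I) := by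
      push_cast
      gcongr
      · exact Int.floor_le _
      · exact Int.le_ceil _
    have h3 : ((B + R) / s + 1 - (A - R) / s) * (s * I) = I * (B - A) + I * (2 * R + s) := by
      field_simp
      ring
    linarith
  have hlower : I * (B - A) - C - I * (2 * R + s) ≤
      (weightedComb h α s (Set.Icc A B)).toReal := by
    have h2 : ((B - R) / s - ((A + R) / s + 1)) * (s * I) ≤
        (((⌊(B - R) / s⌋ + 1 : ℤ) : ℝ) - ⌈(A + R) / s⌉) * (s * I) := by
      push_cast
      gcongr
      · exact (Int.lt_floor_add_one _).le
      · exact (Int.ceil_lt_add_one _).le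
    have h3 : ((B - R) / s - ((A + R) / s + 1)) * (s * I) = I * (B - A) - I * (2 * R + s) := by
      field_simp
      ring
    rcases le_total ⌈(A + R) / s⌉ (⌊(B - R) / s⌋ + 1) with hMN | hMN
    · have h1 := (abs_le.1 (hC _ _ hMN)).1
      linarith
    · have h4 : (((⌊(B - R) / s⌋ + 1 : ℤ) : ℝ) - ⌈(A + R) / s⌉) ≤ 0 :=
        sub_nonpos.2 (by exact_mod_cast hMN)
      have h5 := mul_nonpos_of_nonpos_of_nonneg h4 hsI
      linarith
  rw [abs_lt]
  constructor <;> linarith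

end


/-- The weighted `1×1` cut-and-project Dirac comb `ω = ∑_{g ∈ ℤ²} h(⟨g,v⟩)·δ_{⟨g,u⟩}`
with a continuous piecewise linear weight function `h` supported on the window `[a,b]`
is bounded distance equivalent to `m·λ` with `m = ∫_a^b h`. -/
theorem weightedCPS_bddDist_of_piecewiseLinear
    (α : ℝ) (hα : Irrational α) (hαpos : 0 < α) (hstar : CondStar α)
    (a b : ℝ) (hab : a < b)
    (h : ℝ → ℝ) (hcont : Continuous h)
    (hsupp : ∀ x : ℝ, x ∉ Set.Icc a b → h x = 0)
    (hpos : ∀ x ∈ Set.Ioo a b, 0 < h x)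
    (hpl : ∃ (k : ℕ) (t : ℕ → ℝ), 0 < k ∧ t 0 = a ∧ t k = b ∧
      (∀ i < k, t i < t (i + 1)) ∧
      ∀ i < k, ∃ c d : ℝ, ∀ x ∈ Set.Icc (t i) (t (i + 1)), h x = c * x + d)
    (u v : ℝ × ℝ)
    (hu : u = (1 / Real.sqrt (1 + α ^ 2), α / Real.sqrt (1 + α ^ 2)))
    (hv : v = (-α / Real.sqrt (1 + α ^ 2), 1 / Real.sqrt (1 + α ^ 2)))
    (ω : Measure ℝ)
    (hω : ω = Measure.sum (fun g : ℤ × ℤ =>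
      ENNReal.ofReal (h ((g.1 : ℝ) * v.1 + (g.2 : ℝ) * v.2)) •
        Measure.dirac ((g.1 : ℝ) * u.1 + (g.2 : ℝ) * u.2))) :
    BddDistMeasures ω (ENNReal.ofReal (∫ t in a..b, h t) • (volume : Measure ℝ)) := by
  obtain ⟨k, t, -, ht0, htk, htlt, haff⟩ := hpl
  have hmono : ∀ j n, j ≤ n → n ≤ k → t j ≤ t n := by
    intro j n hjn
    induction n, hjn using Nat.le_induction with
    | base => exact fun _ => le_rfl
    | succ n _ ih => exact fun hn => (ih (by omega)).trans (htlt n (by omega)).le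
  have hleft : ∀ x ≤ t 0, h x = 0 := by
    have hcl : closure (Set.Iio a) ⊆ {x | h x = 0} :=
      closure_minimal (fun x hx => hsupp x fun hx' => (hx'.1.trans_lt hx).false)
        (isClosed_eq hcont continuous_const)
    rw [closure_Iio, ← ht0] at hcl
    exact fun x hx => hcl hx
  have hright : ∀ x, t k ≤ x → h x = 0 := by
    have hcl : closure (Set.Ioi b) ⊆ {x | h x = 0} :=
      closure_minimal (fun x hx => hsupp x fun hx' => (hx'.2.trans_lt hx).false)
        (isClosed_eq hcont continuous_const)
    rw [closure_Ioi, ← htk] at hcl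
    exact fun x hx => hcl hx
  have h0 : ∀ x, 0 ≤ h x := by
    intro x
    rcases le_or_gt x a with hxa | hxa
    · exact (hleft x (ht0 ▸ hxa)).ge
    rcases le_or_gt b x with hxb | hxb
    · exact (hright x (htk ▸ hxb)).ge
    exact (hpos x ⟨hxa, hxb⟩).le
  obtain ⟨c, hc, hc0, hct⟩ := exists_eq_sum_posPart hmono hleft hright haff
  obtain ⟨κ, hκ, hdio⟩ := exists_diophantine hα hstar
  have hs : 0 < √(1 + α ^ 2) := by positivity
  have hsum := exists_abs_sum_Ico_sub_le hc hc0 hct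
    (fun j hj => ht0 ▸ hmono 0 j (Nat.zero_le _) (Finset.mem_range_succ_iff.1 hj))
    (fun j hj => htk ▸ hmono j k (Finset.mem_range_succ_iff.1 hj) le_rfl) hs
    (exists_abs_sum_periodicBernoulliTwo_le hα hκ hdio)
  have hω' : ω = weightedComb h α √(1 + α ^ 2) := by
    rw [hω, weightedComb]
    congr 1
    ext1 g
    have hsq : √(1 + α ^ 2) ^ 2 = 1 + α ^ 2 := Real.sq_sqrt (by positivity)
    have hweight : (g.1 : ℝ) * v.1 + g.2 * v.2 = (g.2 - g.1 * α) / √(1 + α ^ 2) := by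
      rw [hv]
      ring
    have hpoint : (g.1 : ℝ) * u.1 + g.2 * u.2 =
        √(1 + α ^ 2) * g.1 + α * ((g.2 - g.1 * α) / √(1 + α ^ 2)) := by
      rw [hu]
      field_simp
      linear_combination -(g.1 : ℝ) * hsq
    rw [hweight, hpoint]
  rw [hω']
  exact bddDistMeasures_weightedComb hsupp h0 hs hαpos
    (intervalIntegral.integral_nonneg hab.le fun x _ => h0 x) hsum
end

section
/- Let β be a quadratic irrational, i.e. an irrational real number that is a root of a quadratic polynomial with rational coefficients, and let β′ be its algebraic conjugate (the other root of that polynomial). Let a < b be reals and let h : ℝ → ℝ be continuous with h = 0 outside [a,b] and h > 0 on (a,b), and assume h is either piecewise linear (affine on each interval of some finite partition of [a,b]) or twice differentiable on (a,b) with h″ uniformly bounded on (a,b). Consider the weighted Dirac comb ω = ∑_{(m,n)∈ℤ²} h(m + nβ′)·δ_{m + nβ} on ℝ. Then ω is bounded distance equivalent to m₀·λ, where λ is Lebesgue measure on ℝ and m₀ = (1/|β − β′|)·∫_a^b h(t) dt. -/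
open MeasureTheory

/-- A set of positive integers whose square roots are uniformly separated has a convergent
sum of reciprocals. -/
theorem summable_inv_of_sqrt_separated {B : Set ℕ} {δ : ℝ} (hδ : 0 < δ) (hδ1 : δ ≤ 1)
    (hB : ∀ k ∈ B, 1 ≤ k) (hsep : ∀ k ∈ B, ∀ l ∈ B, k < l → δ ≤ √(l : ℝ) - √(k : ℝ)) :
    Summable (fun k : B => 1 / ((k : ℕ) : ℝ)) := by
  have hfl : ∀ k ∈ B, ∀ l ∈ B, k < l → ⌊√(k : ℝ) / δ⌋₊ < ⌊√(l : ℝ) / δ⌋₊ := by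
    intro k hk l hl hkl
    have h1 : √(k : ℝ) / δ + 1 ≤ √(l : ℝ) / δ := by
      rw [div_add_one hδ.ne', div_le_div_iff_of_pos_right hδ]
      linarith [hsep k hk l hl hkl]
    have h2 := Nat.floor_le_floor h1
    rw [Nat.floor_add_one (by positivity)] at h2
    omega
  have hinj : Function.Injective (fun k : B => ⌊√((k : ℕ) : ℝ) / δ⌋₊) := by
    intro k l hkl
    rcases lt_trichotomy (k : ℕ) l with h | h | h
    · exact absurd hkl (hfl k k.2 l l.2 h).ne
    · exact Subtype.ext h
    · exact absurd hkl (hfl l l.2 k k.2 h).ne'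
  have hs : Summable (fun n : ℕ => (1 / δ ^ 2) * (1 / (n : ℝ) ^ 2)) :=
    (Real.summable_one_div_nat_pow.2 one_lt_two).mul_left _
  refine Summable.of_nonneg_of_le (fun _ => by positivity) (fun k => ?_)
    (hs.comp_injective hinj)
  have hk : (1 : ℝ) ≤ (k : ℕ) := by exact_mod_cast hB k k.2
  have hsq : (1 : ℝ) ≤ √((k : ℕ) : ℝ) := Real.one_le_sqrt.2 hk
  have hpos : (1 : ℝ) ≤ (⌊√((k : ℕ) : ℝ) / δ⌋₊ : ℕ) := by
    have : 1 ≤ ⌊√((k : ℕ) : ℝ) / δ⌋₊ := by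
      rw [Nat.one_le_floor_iff, le_div_iff₀ hδ]
      linarith
    exact_mod_cast this
  have hle : (⌊√((k : ℕ) : ℝ) / δ⌋₊ : ℝ) * δ ≤ √((k : ℕ) : ℝ) := by
    rw [← le_div_iff₀ hδ]
    exact Nat.floor_le (by positivity)
  simp only [Function.comp_apply]
  rw [one_div_mul_one_div]
  apply one_div_le_one_div_of_le (by positivity)
  rw [← mul_pow, mul_comm]
  calc _ ≤ √((k : ℕ) : ℝ) ^ 2 := by gcongr
    _ = _ := Real.sq_sqrt (by positivity)

/-- Summability of `1 / (k² D k)` when `D` is subadditive under differences and at least `c / k`. -/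
theorem summable_inv_sq_mul_of_badly_approximable {D : ℕ → ℝ} {c : ℝ} (hc : 0 < c)
    (hD : ∀ k l, k ≤ l → D (l - k) ≤ D l + D k) (hlow : ∀ k, 1 ≤ k → c / k ≤ D k) :
    Summable (fun k : ℕ => 1 / ((k : ℝ) ^ 2 * D k)) := by
  set B : Set ℕ := {k | 1 ≤ k ∧ D k < 1 / √(k : ℝ)}
  have hB : Summable (fun k : B => 1 / ((k : ℕ) : ℝ)) := by
    refine summable_inv_of_sqrt_separated (δ := min (c / 6) 1) (by positivity) (min_le_right _ _)
      (fun k hk => hk.1) ?_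
    intro k hk l hl hkl
    have hk1 : (1 : ℝ) ≤ k := by exact_mod_cast hk.1
    have hkl' : (k : ℝ) < l := by exact_mod_cast hkl
    have hs1 : (1 : ℝ) ≤ √(k : ℝ) := Real.one_le_sqrt.2 hk1
    have hsl : √(k : ℝ) ≤ √(l : ℝ) := Real.sqrt_le_sqrt hkl'.le
    have hsk := Real.sq_sqrt (show (0 : ℝ) ≤ k by positivity)
    have hsl2 := Real.sq_sqrt (show (0 : ℝ) ≤ l by positivity)
    have h1 := hlow (l - k) (by omega)
    have h2 := hD k l hkl.le
    rw [Nat.cast_sub hkl.le] at h1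
    have h3 : 1 / √(l : ℝ) ≤ 1 / √(k : ℝ) := one_div_le_one_div_of_le (by linarith) hsl
    have h4 : c / ((l : ℝ) - k) ≤ 2 / √(k : ℝ) := by
      have := hk.2
      have := hl.2
      have : 2 / √(k : ℝ) = 1 / √(k : ℝ) + 1 / √(k : ℝ) := by ring
      linarith
    rw [div_le_div_iff₀ (by linarith) (by linarith)] at h4
    generalize √(k : ℝ) = x at *
    generalize √(l : ℝ) = y at *
    by_cases hxy : y ≤ 2 * x
    · refine (min_le_left _ _).trans ?_
      have : c * x ≤ 2 * (y - x) * (3 * x) := by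
        nlinarith
      nlinarith
    · exact (min_le_right _ _).trans (by linarith)
  have hB' := (summable_subtype_iff_indicator (f := fun k : ℕ => 1 / (k : ℝ))).1 hB
  have hS : Summable (fun k : ℕ => 1 / (k : ℝ) ^ (3 / 2 : ℝ)) :=
    Real.summable_one_div_nat_rpow.2 (by norm_num)
  refine Summable.of_norm_bounded (hS.add (hB'.mul_left (1 / c))) (fun k => ?_)
  rcases Nat.eq_zero_or_pos k with rfl | hk
  · simp [Set.indicator]
  have hk1 : (0 : ℝ) < k := by exact_mod_cast hk
  have hDk := hlow k hk
  have hD0 : 0 < D k := lt_of_lt_of_le (by positivity) hDk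
  rw [Real.norm_of_nonneg (by positivity)]
  by_cases hkB : k ∈ B
  · rw [Set.indicator_of_mem hkB]
    have : 1 / ((k : ℝ) ^ 2 * D k) ≤ 1 / c * (1 / k) := by
      rw [one_div_mul_one_div]
      apply one_div_le_one_div_of_le (by positivity)
      rw [div_le_iff₀ hk1] at hDk
      nlinarith
    have : 0 ≤ 1 / (k : ℝ) ^ (3 / 2 : ℝ) := by positivity
    linarith
  · rw [Set.indicator_of_notMem hkB, mul_zero, add_zero]
    have hge : 1 / √(k : ℝ) ≤ D k := not_lt.1 fun h => hkB ⟨hk, h⟩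
    apply one_div_le_one_div_of_le (by positivity)
    calc (k : ℝ) ^ (3 / 2 : ℝ) = (k : ℝ) ^ 2 * (1 / √(k : ℝ)) := by
          rw [Real.sqrt_eq_rpow, one_div, ← Real.rpow_neg hk1.le, ← Real.rpow_natCast,
            ← Real.rpow_add hk1]
          norm_num
      _ ≤ _ := by gcongr

/-- Quadratic irrationals are badly approximable. -/
theorem exists_pos_le_abs_mul_sub_of_quadratic {α : ℝ} (hα : Irrational α) {p q r : ℚ} (hp : p ≠ 0)
    (hroot : (p : ℝ) * α ^ 2 + (q : ℝ) * α + (r : ℝ) = 0) :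
    ∃ c > 0, ∀ k : ℕ, 1 ≤ k → ∀ m : ℤ, c / k ≤ |k * α - m| := by
  let P : ℤ := p.num * q.den * r.den
  let Q : ℤ := q.num * p.den * r.den
  let R : ℤ := r.num * p.den * q.den
  have hP : P ≠ 0 := by simp [P, hp]
  let f : Polynomial ℤ := .C P * .X ^ 2 + .C Q * .X + .C R
  have hdeg : f.natDegree = 2 := Polynomial.natDegree_quadratic hP
  have hf0 : f ≠ 0 := by
    intro h
    simp [h] at hdeg
  have hev : Polynomial.eval α (f.map (algebraMap ℤ ℝ)) = 0 := by
    have hpd : (p.den : ℝ) ≠ 0 := by exact_mod_cast p.den_nz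
    have hqd : (q.den : ℝ) ≠ 0 := by exact_mod_cast q.den_nz
    have hrd : (r.den : ℝ) ≠ 0 := by exact_mod_cast r.den_nz
    rw [Rat.cast_def p, Rat.cast_def q, Rat.cast_def r] at hroot
    field_simp at hroot
    simp [f, P, Q, R]
    linear_combination hroot
  obtain ⟨A, hA, h⟩ := Liouville.exists_pos_real_of_irrational_root hα hf0 hev
  refine ⟨1 / A, by positivity, fun k hk m => ?_⟩
  have hk1 : (0 : ℝ) < k := by exact_mod_cast hk
  have := h m (k - 1)
  rw [hdeg, Nat.cast_sub hk, Nat.cast_one, sub_add_cancel] at this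
  have habs : |α - m / k| = |k * α - m| / k := by
    rw [← abs_of_pos hk1, ← abs_div, abs_of_pos hk1]
    congr 1
    field_simp
  rw [habs] at this
  rw [div_div, div_le_iff₀ (by positivity)]
  calc (1 : ℝ) ≤ _ := this
    _ = _ := by field_simp

/-- The distance from `e^{2πiθ}` to `1` controls the distance from `θ` to the nearest integer. -/
theorem four_mul_abs_sub_round_le_norm_exp_sub_one (θ : ℝ) :
    4 * |θ - round θ| ≤ ‖Complex.exp (2 * Real.pi * Complex.I * θ) - 1‖ := by
  have h1 : Complex.exp (2 * Real.pi * Complex.I * θ)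
      = Complex.exp (Complex.I * (2 * Real.pi * (θ - round θ) : ℝ)) := by
    rw [Complex.exp_eq_exp_iff_exists_int]
    exact ⟨round θ, by push_cast; ring⟩
  rw [h1, Complex.norm_exp_I_mul_ofReal_sub_one, Real.norm_eq_abs, abs_mul, abs_two]
  have h2 := abs_sub_round θ
  have h3 : |2 * Real.pi * (θ - round θ) / 2| = Real.pi * |θ - round θ| := by
    rw [show 2 * Real.pi * (θ - round θ) / 2 = Real.pi * (θ - round θ) by ring, abs_mul,
      abs_of_pos Real.pi_pos]
  have h4 := Real.mul_abs_le_abs_sin (x := 2 * Real.pi * (θ - round θ) / 2) (by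
    rw [h3]
    nlinarith [Real.pi_pos])
  rw [h3] at h4
  have h5 : 2 / Real.pi * (Real.pi * |θ - round θ|) = 2 * |θ - round θ| := by
    field_simp
  linarith

/-- The inverse small divisors of a quadratic rotation, weighted by `1 / k²`, are summable. -/
theorem summable_inv_sq_mul_norm_exp_sub_one {α : ℝ} (hα : Irrational α) {p q r : ℚ} (hp : p ≠ 0)
    (hroot : (p : ℝ) * α ^ 2 + (q : ℝ) * α + (r : ℝ) = 0) :
    Summable (fun k : ℤ =>
      1 / ((k : ℝ) ^ 2 * ‖Complex.exp (2 * Real.pi * Complex.I * (k * α : ℝ)) - 1‖)) := by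
  obtain ⟨c, hc, hlow⟩ := exists_pos_le_abs_mul_sub_of_quadratic hα hp hroot
  have hunit : ∀ x : ℝ, ‖Complex.exp (2 * Real.pi * Complex.I * x)‖ = 1 := fun x => by
    rw [show 2 * Real.pi * Complex.I * x = ((2 * Real.pi * x : ℝ) : ℂ) * Complex.I by
      push_cast; ring]
    exact Complex.norm_exp_ofReal_mul_I _
  have hnat : Summable (fun k : ℕ =>
      1 / ((k : ℝ) ^ 2 * ‖Complex.exp (2 * Real.pi * Complex.I * (k * α : ℝ)) - 1‖)) := by
    refine summable_inv_sq_mul_of_badly_approximable hc (fun k l hkl => ?_) (fun k hk => ?_)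
    · have h1 : Complex.exp (2 * Real.pi * Complex.I * (l * α : ℝ)) =
          Complex.exp (2 * Real.pi * Complex.I * (k * α : ℝ)) *
          Complex.exp (2 * Real.pi * Complex.I * ((l - k : ℕ) * α : ℝ)) := by
        rw [← Complex.exp_add]
        push_cast [Nat.cast_sub hkl]
        ring_nf
      calc _ = ‖Complex.exp (2 * Real.pi * Complex.I * (k * α : ℝ)) *
            (Complex.exp (2 * Real.pi * Complex.I * ((l - k : ℕ) * α : ℝ)) - 1)‖ := by
            rw [norm_mul, hunit, one_mul]
        _ = ‖(Complex.exp (2 * Real.pi * Complex.I * (l * α : ℝ)) - 1) -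
            (Complex.exp (2 * Real.pi * Complex.I * (k * α : ℝ)) - 1)‖ := by
            rw [h1]
            ring_nf
        _ ≤ _ := norm_sub_le _ _
    · have h1 := four_mul_abs_sub_round_le_norm_exp_sub_one (k * α)
      have h2 := hlow k hk (round (k * α))
      have h3 := abs_nonneg ((k : ℝ) * α - round (k * α))
      linarith
  refine Summable.of_nat_of_neg (by simpa using hnat) ?_
  refine hnat.congr fun k => Eq.symm ?_
  have h1 : Complex.exp (2 * Real.pi * Complex.I * (((-(k : ℤ) : ℤ) : ℝ) * α : ℝ)) - 1 =
      -(Complex.exp (2 * Real.pi * Complex.I * (((-(k : ℤ) : ℤ) : ℝ) * α : ℝ))) *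
      (Complex.exp (2 * Real.pi * Complex.I * (k * α : ℝ)) - 1) := by
    rw [mul_sub, neg_mul, ← Complex.exp_add]
    push_cast
    ring_nf
    simp only [Complex.exp_zero]
    ring
  rw [h1, norm_mul, norm_neg, hunit]
  simp

/-- One piece of the oscillatory integral: two integrations by parts. -/
theorem exists_norm_integral_sub_boundary_le {s t : ℝ} (hst : s < t) {h h' h'' : ℝ → ℝ}
    (hcont : Continuous h) (hd : ∀ x ∈ Set.Ioo s t, HasDerivAt h (h' x) x)
    (hd' : ∀ x ∈ Set.Ioo s t, HasDerivAt h' (h'' x) x) {M : ℝ}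
    (hM : ∀ x ∈ Set.Ioo s t, |h'' x| ≤ M) :
    ∃ C, ∀ w : ℂ, w ≠ 0 → w.re = 0 →
      ‖(∫ x in s..t, Complex.exp (w * x) * h x) -
        (Complex.exp (w * t) * h t - Complex.exp (w * s) * h s) / w‖ ≤ C / ‖w‖ ^ 2 := by
  have hlip : LipschitzOnWith M.toNNReal h' (Set.Ioo s t) := by
    refine (convex_Ioo s t).lipschitzOnWith_of_nnnorm_hasDerivWithin_le
      (fun x hx => (hd' x hx).hasDerivWithinAt) (fun x hx => ?_)
    rw [← NNReal.coe_le_coe, coe_nnnorm, Real.norm_eq_abs]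
    exact (hM x hx).trans (Real.le_coe_toNNReal M)
  obtain ⟨g, hg, hgeq⟩ := hlip.extend_real
  have hgd : ∀ x ∈ Set.Ioo s t, HasDerivAt g (h'' x) x := fun x hx =>
    (hd' x hx).congr_of_eventuallyEq
      (Filter.eventuallyEq_of_mem (Ioo_mem_nhds hx.1 hx.2) fun y hy => (hgeq hy).symm)
  have hM0 : 0 ≤ M := (abs_nonneg _).trans
    (hM ((s + t) / 2) ⟨by linarith, by linarith⟩)
  have hexp : ∀ w : ℂ, w.re = 0 → ∀ x : ℝ, ‖Complex.exp (w * x)‖ = 1 := fun w hw x => by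
    rw [Complex.norm_exp]
    simp [hw]
  refine ⟨|g t| + |g s| + M * |t - s|, fun w hw0 hw => ?_⟩
  have hder : ∀ x : ℝ, HasDerivAt (fun y : ℝ => Complex.exp (w * y)) (Complex.exp (w * x) * w) x :=
    fun x => by
      simpa using ((Complex.ofRealCLM.hasDerivAt (x := x)).const_mul w).cexp
  have hint1 : IntervalIntegrable (fun x : ℝ => Complex.exp (w * x) * h x) volume s t :=
    Continuous.intervalIntegrable (by fun_prop) _ _
  have hint2 : IntervalIntegrable (fun x : ℝ => Complex.exp (w * x) * h'' x / w ^ 2)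
      volume s t := by
    rw [intervalIntegrable_iff_integrableOn_Ioo_of_le hst.le]
    refine Integrable.of_bound ?_ (M / ‖w‖ ^ 2) ?_
    · have : AEStronglyMeasurable (fun x : ℝ => Complex.exp (w * x) * (deriv g x : ℝ) / w ^ 2)
          (volume.restrict (Set.Ioo s t)) := by
        have := measurable_deriv g
        exact (by fun_prop : Measurable _).aestronglyMeasurable
      refine this.congr ?_
      filter_upwards [ae_restrict_mem measurableSet_Ioo] with x hx
      rw [(hgd x hx).deriv]
    · filter_upwards [ae_restrict_mem measurableSet_Ioo] with x hx
      rw [norm_div, norm_mul, hexp w hw, one_mul, norm_pow, Complex.norm_real]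
      gcongr
      exact hM x hx
  have hFTC := intervalIntegral.integral_eq_sub_of_hasDerivAt_of_le
    (f := fun x : ℝ => Complex.exp (w * x) * (h x / w - g x / w ^ 2))
    (f' := fun x : ℝ => Complex.exp (w * x) * h x - Complex.exp (w * x) * h'' x / w ^ 2)
    hst.le (Continuous.continuousOn (by have := hg.continuous; fun_prop)) (fun x hx => by
      have h1 := (hd x hx).ofReal_comp
      have h2 := (hgd x hx).ofReal_comp
      have h3 := (hder x).mul ((h1.div_const w).sub (h2.div_const (w ^ 2)))
      convert! h3 using 1
      simp only [Pi.sub_apply, ← hgeq hx]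
      field_simp
      ring) (hint1.sub hint2)
  rw [intervalIntegral.integral_sub hint1 hint2] at hFTC
  have hbound : ‖∫ x in s..t, Complex.exp (w * x) * h'' x / w ^ 2‖ ≤ M / ‖w‖ ^ 2 * |t - s| := by
    refine intervalIntegral.norm_integral_le_of_norm_le_const_ae ?_
    have : ∀ᵐ x : ℝ, x ≠ t := by simp [ae_iff]
    filter_upwards [this] with x hxt hx
    rw [Set.uIoc_of_le hst.le] at hx
    rw [norm_div, norm_mul, hexp w hw, one_mul, norm_pow, Complex.norm_real]
    gcongr
    exact hM x ⟨hx.1, lt_of_le_of_ne hx.2 hxt⟩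
  have hkey : (∫ x in s..t, Complex.exp (w * x) * h x) -
        (Complex.exp (w * t) * h t - Complex.exp (w * s) * h s) / w =
      (∫ x in s..t, Complex.exp (w * x) * h'' x / w ^ 2)
        - Complex.exp (w * t) * g t / w ^ 2 + Complex.exp (w * s) * g s / w ^ 2 := by
    linear_combination hFTC
  rw [hkey]
  have hb : ∀ x : ℝ, ‖Complex.exp (w * x) * g x / w ^ 2‖ = |g x| / ‖w‖ ^ 2 := fun x => by
    rw [norm_div, norm_mul, hexp w hw, one_mul, norm_pow, Complex.norm_real, Real.norm_eq_abs]
  calc _ ≤ M / ‖w‖ ^ 2 * |t - s| + |g t| / ‖w‖ ^ 2 + |g s| / ‖w‖ ^ 2 := by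
        refine (norm_add_le _ _).trans (add_le_add ((norm_sub_le _ _).trans ?_) (hb s).le)
        exact add_le_add hbound (hb t).le
    _ = _ := by ring

/-- The regularity assumption on the weight function `h`: piecewise linear, or twice
differentiable with bounded second derivative. -/
def WeightRegular (a b : ℝ) (h : ℝ → ℝ) : Prop :=
  (∃ (k : ℕ) (t : ℕ → ℝ), 0 < k ∧ t 0 = a ∧ t k = b ∧
    (∀ i < k, t i < t (i + 1)) ∧
    ∀ i < k, ∃ c d : ℝ, ∀ x ∈ Set.Icc (t i) (t (i + 1)), h x = c * x + d) ∨
  (∃ h' h'' : ℝ → ℝ,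
    (∀ x ∈ Set.Ioo a b, HasDerivAt h (h' x) x) ∧
    (∀ x ∈ Set.Ioo a b, HasDerivAt h' (h'' x) x) ∧
    ∃ M : ℝ, ∀ x ∈ Set.Ioo a b, |h'' x| ≤ M)

/-- A regular weight function vanishing at both ends of the window has Fourier integrals of
quadratic decay. -/
theorem WeightRegular.exists_norm_integral_exp_mul_le {a b : ℝ} (hab : a < b) {h : ℝ → ℝ}
    (hcont : Continuous h) (ha : h a = 0) (hb : h b = 0) (hreg : WeightRegular a b h) :
    ∃ C, ∀ w : ℂ, w ≠ 0 → w.re = 0 →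
      ‖∫ x in a..b, Complex.exp (w * x) * h x‖ ≤ C / ‖w‖ ^ 2 := by
  rcases hreg with ⟨k, t, -, h0, hk, hlt, haff⟩ | ⟨h', h'', hd, hd', M, hM⟩
  · have main : ∀ i ≤ k, ∃ C, ∀ w : ℂ, w ≠ 0 → w.re = 0 →
        ‖(∫ x in a..t i, Complex.exp (w * x) * h x) - Complex.exp (w * t i) * h (t i) / w‖
          ≤ C / ‖w‖ ^ 2 := by
      intro i
      induction i with
      | zero => exact fun _ => ⟨0, fun w _ _ => by simp [h0, ha]⟩
      | succ i ih =>
        intro hi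
        obtain ⟨C₁, hC₁⟩ := ih (by omega)
        obtain ⟨c, d, hcd⟩ := haff i (by omega)
        obtain ⟨C₂, hC₂⟩ := exists_norm_integral_sub_boundary_le (hlt i (by omega))
          (h' := fun _ => c) (h'' := fun _ => 0) hcont (fun x hx => by
            have : HasDerivAt (fun y => c * y + d) c x := by
              simpa using ((hasDerivAt_id x).const_mul c).add_const d
            exact this.congr_of_eventuallyEq (Filter.eventuallyEq_of_mem
              (Icc_mem_nhds hx.1 hx.2) hcd)) (fun x _ => hasDerivAt_const x c) (M := 0) (by simp)
        refine ⟨C₁ + C₂, fun w hw0 hw => ?_⟩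
        have hi : ∀ u v : ℝ, IntervalIntegrable (fun x : ℝ => Complex.exp (w * x) * h x)
            volume u v := fun u v => Continuous.intervalIntegrable (by fun_prop) _ _
        rw [← intervalIntegral.integral_add_adjacent_intervals (hi a (t i)) (hi _ _), add_div]
        refine le_trans (le_of_eq ?_) ((norm_add_le _ _).trans
          (add_le_add (hC₁ w hw0 hw) (hC₂ w hw0 hw)))
        congr 1
        ring
    simpa [hk, hb] using main k le_rfl
  · simpa [ha, hb] using exists_norm_integral_sub_boundary_le hab hcont hd hd' hM

open FourierTransform in
/-- Along the orbit of a quadratic rotation, the periodization of a regular weight function is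
cohomologous to its mean, with bounded transfer function. -/
theorem exists_bounded_transfer {α : ℝ} (hα : Irrational α) {p q r : ℚ} (hp : p ≠ 0)
    (hroot : (p : ℝ) * α ^ 2 + (q : ℝ) * α + (r : ℝ) = 0)
    {a b : ℝ} (hab : a < b) {h : ℝ → ℝ} (hcont : Continuous h)
    (hsupp : ∀ x, x ∉ Set.Ioo a b → h x = 0) (hreg : WeightRegular a b h) :
    ∃ (G : ℤ → ℝ) (K : ℝ), (∀ n, |G n| ≤ K) ∧
      ∀ n : ℤ, ∑' m : ℤ, h (n * α + m) = (∫ x in a..b, h x) + G (n + 1) - G n := by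
  obtain ⟨C, hC⟩ := hreg.exists_norm_integral_exp_mul_le hab hcont
    (hsupp a (by simp)) (hsupp b (by simp))
  have hC0 : 0 ≤ C := by
    have := (norm_nonneg _).trans (hC Complex.I Complex.I_ne_zero (by simp))
    simpa using this
  set f : ℝ → ℂ := fun x => h x with hf
  have hfc : Continuous f := by fun_prop
  have hFeq : ∀ ξ : ℝ, 𝓕 f ξ =
      ∫ x in a..b, Complex.exp ((((-2 * Real.pi * ξ : ℝ) : ℂ) * Complex.I) * x) * h x := by
    intro ξ
    rw [Real.fourier_real_eq_integral_exp_smul, intervalIntegral.integral_of_le hab.le,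
      ← integral_Icc_eq_integral_Ioc, ← MeasureTheory.setIntegral_eq_integral_of_forall_compl_eq_zero
        (s := Set.Icc a b)]
    · refine integral_congr_ae (Filter.Eventually.of_forall fun x => ?_)
      simp only [smul_eq_mul, hf]
      push_cast
      ring_nf
    · intro x hx
      simp [hf, hsupp x fun h => hx (Set.Ioo_subset_Icc_self h)]
  have hF0 : 𝓕 f ((0 : ℤ) : ℝ) = ((∫ x in a..b, h x : ℝ) : ℂ) := by
    rw [hFeq, ← intervalIntegral.integral_ofReal]
    simp
  have hFb : ∀ k : ℤ, k ≠ 0 → ‖𝓕 f k‖ ≤ C / (k : ℝ) ^ 2 := by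
    intro k hk
    have hk' : (k : ℝ) ≠ 0 := by exact_mod_cast hk
    rw [hFeq]
    refine (hC _ (mul_ne_zero ?_ Complex.I_ne_zero) (by simp)).trans ?_
    · have := Real.pi_ne_zero
      exact_mod_cast (by positivity : (-2 * Real.pi * k : ℝ) ≠ 0)
    · rw [norm_mul, Complex.norm_I, mul_one, Complex.norm_real, Real.norm_eq_abs, sq_abs]
      have := Real.two_le_pi
      have : (k : ℝ) ^ 2 ≤ (-2 * Real.pi * k) ^ 2 := by
        have : 1 ≤ (-2 * Real.pi) ^ 2 := by nlinarith
        rw [mul_pow]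
        nlinarith [sq_nonneg (k : ℝ)]
      gcongr
  have hFs : Summable fun k : ℤ => 𝓕 f k := by
    have h1 : Summable fun k : ℤ => C * (1 / (k : ℝ) ^ 2) :=
      (Real.summable_one_div_int_pow.2 one_lt_two).mul_left C
    refine Summable.of_norm_bounded_eventually h1 ?_
    filter_upwards [(Set.finite_singleton (0 : ℤ)).compl_mem_cofinite] with k hk
    rw [mul_one_div]
    exact hFb k hk
  have hfO : f =O[Filter.cocompact ℝ] fun x : ℝ => |x| ^ (-2 : ℝ) := by
    refine Asymptotics.IsBigO.of_bound 1 ?_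
    filter_upwards [(isCompact_Icc (a := a) (b := b)).compl_mem_cocompact] with x hx
    rw [hf]
    simp only [hsupp x fun h => hx (Set.Ioo_subset_Icc_self h)]
    simp only [Complex.ofReal_zero, norm_zero]
    positivity
  set E : ℤ → ℂ := fun k => Complex.exp (2 * Real.pi * Complex.I * (k * α : ℝ)) with hE
  have hEnorm : ∀ k, ‖E k‖ = 1 := fun k => by
    rw [hE]
    simp only
    rw [show 2 * Real.pi * Complex.I * (k * α : ℝ) = ((2 * Real.pi * (k * α) : ℝ) : ℂ) * Complex.I by
      push_cast; ring]
    exact Complex.norm_exp_ofReal_mul_I _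
  have hE0 : ∀ k, E k ≠ 0 := fun k => Complex.exp_ne_zero _
  have hE1 : ∀ k, k ≠ 0 → E k - 1 ≠ 0 := by
    intro k hk h0
    have h1 := four_mul_abs_sub_round_le_norm_exp_sub_one (k * α)
    have h2 : ‖E k - 1‖ = 0 := by rw [h0, norm_zero]
    have h3 : (k : ℝ) * α - round ((k : ℝ) * α) = 0 :=
      abs_nonpos_iff.1 (by simp only [hE] at h2; linarith)
    exact (hα.intCast_mul hk).ne_int _ (sub_eq_zero.1 h3)
  set T : ℤ → ℤ → ℂ := fun n k => 𝓕 f k * E k ^ n / (E k - 1) with hT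
  have hTb : ∀ n k, ‖T n k‖ ≤ C * (1 / ((k : ℝ) ^ 2 * ‖E k - 1‖)) := by
    intro n k
    by_cases hk : k = 0
    · simp [hT, hE, hk]
    · rw [hT]
      simp only
      rw [norm_div, norm_mul, norm_zpow, hEnorm, one_zpow, mul_one, mul_one_div,
        ← div_div]
      gcongr
      exact hFb k hk
  have hsum := (summable_inv_sq_mul_norm_exp_sub_one hα hp hroot).mul_left C
  have hTs : ∀ n, Summable (T n) := fun n => Summable.of_norm_bounded hsum (hTb n)
  refine ⟨fun n => (∑' k, T n k).re, _, fun n =>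
    (Complex.abs_re_le_norm _).trans (tsum_of_norm_bounded hsum.hasSum (hTb n)), fun n => ?_⟩
  have hP := Real.tsum_eq_tsum_fourier_of_rpow_decay_of_summable hfc one_lt_two hfO hFs (n * α)
  have hterm : ∀ k : ℤ, 𝓕 f k * fourier k ((n * α : ℝ) : UnitAddCircle) = 𝓕 f k * E k ^ n := by
    intro k
    rw [fourier_coe_apply, hE]
    simp only
    rw [← Complex.exp_int_mul]
    push_cast
    ring_nf
  simp_rw [hterm] at hP
  have hs : Summable fun k : ℤ => 𝓕 f k * E k ^ n := by
    refine Summable.of_norm_bounded hFs.norm fun k => ?_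
    rw [norm_mul, norm_zpow, hEnorm, one_zpow, mul_one]
  rw [hs.tsum_eq_add_tsum_ite 0] at hP
  have hdiff : ∀ k : ℤ, (if k = 0 then 0 else 𝓕 f k * E k ^ n) = T (n + 1) k - T n k := by
    intro k
    split_ifs with hk
    · simp [hT, hE, hk]
    · have := hE1 k hk
      simp only [hT]
      rw [zpow_add_one₀ (hE0 k)]
      field_simp
  simp_rw [hdiff] at hP
  rw [(hTs (n + 1)).tsum_sub (hTs n), hF0] at hP
  have hE00 : E 0 ^ n = 1 := by simp [hE]
  rw [hE00, mul_one] at hP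
  have hre := congrArg Complex.re hP
  rw [hf, ← Complex.ofReal_tsum] at hre
  simp only [Complex.ofReal_re, Complex.add_re, Complex.sub_re] at hre
  rw [hre]
  ring

/-- The number of integers in `[u, v]` differs from `v - u` by at most one. -/
theorem abs_card_Icc_ceil_floor_sub_le {u v : ℝ} (huv : u ≤ v) :
    |((Finset.Icc ⌈u⌉ ⌊v⌋).card : ℝ) - (v - u)| ≤ 1 := by
  have h1 : ⌈u⌉ ≤ ⌊v⌋ + 1 := Int.ceil_le.2 (by push_cast; linarith [Int.lt_floor_add_one v])
  have h2 : ((Finset.Icc ⌈u⌉ ⌊v⌋).card : ℤ) = ⌊v⌋ + 1 - ⌈u⌉ := by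
    rw [Int.card_Icc, Int.toNat_of_nonneg (by omega)]
  have h3 : ((Finset.Icc ⌈u⌉ ⌊v⌋).card : ℝ) = ⌊v⌋ + 1 - ⌈u⌉ := by exact_mod_cast h2
  rw [h3, abs_le]
  have := Int.ceil_lt_add_one u
  have := Int.le_ceil u
  have := Int.lt_floor_add_one v
  have := Int.floor_le v
  constructor <;> linarith

/-- Sums over integer intervals of a function cohomologous to a constant. -/
theorem abs_sum_Icc_sub_le_of_transfer {F G : ℤ → ℝ} {I K : ℝ} (hG : ∀ n, |G n| ≤ K)
    (hF : ∀ n, F n = I + G (n + 1) - G n) {u v : ℝ} (huv : u ≤ v) :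
    |∑ n ∈ Finset.Icc ⌈u⌉ ⌊v⌋, F n - I * (v - u)| ≤ |I| + 2 * K := by
  have htel : ∀ (p : ℤ) (N : ℕ), ∑ n ∈ Finset.Ico p (p + N), (G (n + 1) - G n) =
      G (p + N) - G p := by
    intro p N
    induction N with
    | zero => simp
    | succ N ih =>
      rw [Nat.cast_succ, ← add_assoc, ← Finset.insert_Ico_right_eq_Ico_add_one (by omega),
        Finset.sum_insert Finset.right_notMem_Ico, ih]
      ring
  have h1 : ⌈u⌉ ≤ ⌊v⌋ + 1 := Int.ceil_le.2 (by push_cast; linarith [Int.lt_floor_add_one v])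
  obtain ⟨N, hN⟩ := Int.eq_ofNat_of_zero_le (sub_nonneg.2 h1)
  have hIco : Finset.Icc ⌈u⌉ ⌊v⌋ = Finset.Ico ⌈u⌉ (⌈u⌉ + N) := by
    ext n
    simp only [Finset.mem_Icc, Finset.mem_Ico]
    omega
  have hsum : ∑ n ∈ Finset.Icc ⌈u⌉ ⌊v⌋, F n =
      (Finset.Icc ⌈u⌉ ⌊v⌋).card * I + (G (⌈u⌉ + N) - G ⌈u⌉) := by
    rw [← htel, ← hIco, ← nsmul_eq_mul, ← Finset.sum_const, ← Finset.sum_add_distrib]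
    exact Finset.sum_congr rfl fun n _ => by rw [hF]; ring
  rw [hsum]
  calc _ = |I * ((Finset.Icc ⌈u⌉ ⌊v⌋).card - (v - u)) + (G (⌈u⌉ + N) - G ⌈u⌉)| := by ring_nf
    _ ≤ |I| * 1 + (K + K) := by
      refine (abs_add_le _ _).trans (add_le_add ?_ ((abs_sub _ _).trans
        (add_le_add (hG _) (hG _))))
      rw [abs_mul]
      exact mul_le_mul_of_nonneg_left (abs_card_Icc_ceil_floor_sub_le huv) (abs_nonneg _)
    _ = _ := by ring

/-- A translate of a compactly supported function has finite support on the integers. -/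
theorem finite_support_add_intCast {a b : ℝ} {h : ℝ → ℝ} (hsupp : ∀ x, x ∉ Set.Ioo a b → h x = 0)
    (y : ℝ) : (Function.support fun m : ℤ => h (y + m)).Finite := by
  refine (Set.finite_Icc ⌈a - y⌉ ⌊b - y⌋).subset fun m hm => ?_
  have h1 : y + m ∈ Set.Ioo a b := by
    by_contra h2
    exact hm (hsupp _ h2)
  exact ⟨Int.ceil_le.2 (by linarith [h1.1]), Int.le_floor.2 (by linarith [h1.2])⟩

/-- The weighted Dirac comb gives a compact interval, up to a bounded error, the mass of a sum of
the periodization of `h` over an integer interval. -/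
theorem exists_abs_comb_Icc_sub_sum_le {β β' : ℝ} (hne : β - β' ≠ 0) {a b : ℝ}
    {h : ℝ → ℝ} (hnn : ∀ x, 0 ≤ h x) (hsupp : ∀ x, x ∉ Set.Ioo a b → h x = 0) {R : ℝ}
    (hR : ∀ n : ℤ, ∑' m : ℤ, h (n * β' + m) ≤ R) :
    ∃ C, ∀ A B : ℝ, A ≤ B →
      |((Measure.sum (fun g : ℤ × ℤ => ENNReal.ofReal (h ((g.1 : ℝ) + (g.2 : ℝ) * β')) •
        Measure.dirac ((g.1 : ℝ) + (g.2 : ℝ) * β)) : Measure ℝ) (Set.Icc A B)).toReal -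
      ∑ n ∈ Finset.Icc ⌈min (A / (β - β')) (B / (β - β'))⌉ ⌊max (A / (β - β')) (B / (β - β'))⌋,
        ∑' m : ℤ, h (n * β' + m)| ≤ C := by
  set Δ := β - β' with hΔ
  set L := |a| + |b| with hL
  set L' := L / |Δ| with hL'
  have hΔ0 : 0 < |Δ| := abs_pos.2 hne
  have hL0 : 0 ≤ L' := by positivity
  have hR0 : 0 ≤ R := (tsum_nonneg fun m => hnn _).trans (hR 0)
  refine ⟨2 * (2 * L' + 1) * R, fun A B hAB => ?_⟩
  set F : ℤ → ℝ := fun n => ∑' m : ℤ, h (n * β' + m) with hF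
  set Φ : ℤ → ℝ := fun n =>
    ∑' m : ℤ, if (m : ℝ) + n * β ∈ Set.Icc A B then h (n * β' + m) else 0 with hΦ
  set J := Finset.Icc ⌈min (A / Δ) (B / Δ)⌉ ⌊max (A / Δ) (B / Δ)⌋ with hJ
  set S : ℝ → Finset ℤ := fun X => Finset.Icc ⌈X / Δ - L'⌉ ⌊X / Δ + L'⌋ with hS
  have hnn' : ∀ n m : ℤ, 0 ≤ if (m : ℝ) + n * β ∈ Set.Icc A B then h (n * β' + m) else 0 :=
    fun n m => by split_ifs <;> simp [hnn]
  have hsumF : ∀ n : ℤ, Summable fun m : ℤ => h (n * β' + m) := fun n =>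
    summable_of_hasFiniteSupport (finite_support_add_intCast hsupp _)
  have hsumΦ : ∀ n : ℤ, Summable fun m : ℤ =>
      if (m : ℝ) + n * β ∈ Set.Icc A B then h (n * β' + m) else 0 := fun n =>
    Summable.of_nonneg_of_le (hnn' n) (fun m => by split_ifs <;> simp [hnn]) (hsumF n)
  have hΦ0 : ∀ n, 0 ≤ Φ n := fun n => tsum_nonneg (hnn' n)
  have hF0 : ∀ n, 0 ≤ F n := fun n => tsum_nonneg fun _ => hnn _
  have hΦF : ∀ n, Φ n ≤ F n := fun n =>
    (hsumΦ n).tsum_le_tsum (fun m => by split_ifs <;> simp [hnn]) (hsumF n)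
  have hmemJ : ∀ n : ℤ, n ∈ J ↔ (n : ℝ) * Δ ∈ Set.Icc A B := by
    intro n
    rw [hJ, Finset.mem_Icc, Int.ceil_le, Int.le_floor]
    rcases lt_or_gt_of_ne hne with hneg | hpos
    · have : B / Δ ≤ A / Δ := div_le_div_of_nonpos_of_le hneg.le hAB
      rw [min_eq_right this, max_eq_left this, div_le_iff_of_neg hneg, le_div_iff_of_neg hneg]
      exact and_comm
    · have : A / Δ ≤ B / Δ := by gcongr
      rw [min_eq_left this, max_eq_right this, div_le_iff₀ hpos, le_div_iff₀ hpos]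
      rfl
  have hmemS : ∀ (X : ℝ) (n : ℤ), n ∉ S X → L < |n * Δ - X| := by
    intro X n hn
    rw [hS, Finset.mem_Icc, Int.ceil_le, Int.le_floor, sub_le_iff_le_add, ← sub_le_iff_le_add'] at hn
    have h1 : L' < |n - X / Δ| := by
      by_contra! h2
      rw [abs_le] at h2
      exact hn ⟨by linarith, by linarith⟩
    have h2 : n * Δ - X = (n - X / Δ) * Δ := by field_simp
    rw [h2, abs_mul]
    rwa [hL', div_lt_iff₀ hΔ0] at h1
  have hcardS : ∀ X, ((S X).card : ℝ) ≤ 2 * L' + 1 := by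
    intro X
    have := (abs_le.1 (abs_card_Icc_ceil_floor_sub_le
      (show X / Δ - L' ≤ X / Δ + L' by linarith))).2
    simp only [hS]
    linarith
  have hgood : ∀ n, n ∉ S A ∪ S B → Φ n = if n ∈ J then F n else 0 := by
    intro n hn
    rw [Finset.notMem_union] at hn
    have hA := hmemS A n hn.1
    have hB := hmemS B n hn.2
    have hiff : ∀ m : ℤ, n * β' + m ∈ Set.Ioo a b →
        ((m : ℝ) + n * β ∈ Set.Icc A B ↔ n ∈ J) := by
      intro m hm
      rw [hmemJ]
      have h1 : (m : ℝ) + n * β = n * Δ + (n * β' + m) := by rw [hΔ]; ring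
      have h2 : |n * β' + m| ≤ L := by
        have := neg_abs_le a
        have := le_abs_self b
        have := abs_nonneg a
        have := abs_nonneg b
        rw [abs_le]
        exact ⟨by linarith [hm.1], by linarith [hm.2]⟩
      rw [h1]
      rw [abs_le] at h2
      simp only [Set.mem_Icc]
      constructor
      · rintro ⟨h3, h4⟩
        constructor
        · rcases lt_abs.1 hA with h | h <;> linarith
        · rcases lt_abs.1 hB with h | h <;> linarith
      · rintro ⟨h3, h4⟩
        constructor
        · rcases lt_abs.1 hA with h | h <;> linarith
        · rcases lt_abs.1 hB with h | h <;> linarith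
    have hterm : ∀ m : ℤ, (if (m : ℝ) + n * β ∈ Set.Icc A B then h (n * β' + m) else 0) =
        if n ∈ J then h (n * β' + m) else 0 := by
      intro m
      by_cases hm : (n : ℝ) * β' + m ∈ Set.Ioo a b
      · simp only [hiff m hm]
      · simp [hsupp _ hm]
    simp only [hΦ, hF, hterm]
    split_ifs <;> simp
  set T := J ∪ (S A ∪ S B) with hT
  have hΦT : ∀ n, n ∉ T → Φ n = 0 := by
    intro n hn
    rw [hT, Finset.notMem_union] at hn
    rw [hgood n hn.2, if_neg hn.1]
  have hmass : ((Measure.sum (fun g : ℤ × ℤ => ENNReal.ofReal (h ((g.1 : ℝ) + (g.2 : ℝ) * β')) •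
        Measure.dirac ((g.1 : ℝ) + (g.2 : ℝ) * β)) : Measure ℝ) (Set.Icc A B)).toReal =
      ∑ n ∈ T, Φ n := by
    rw [Measure.sum_apply _ measurableSet_Icc, ENNReal.tsum_prod', ENNReal.tsum_comm]
    have h1 : ∀ n : ℤ, ∑' m : ℤ, (ENNReal.ofReal (h ((m : ℝ) + (n : ℝ) * β')) •
        Measure.dirac ((m : ℝ) + (n : ℝ) * β) : Measure ℝ) (Set.Icc A B) =
        ENNReal.ofReal (Φ n) := by
      intro n
      rw [hΦ, ENNReal.ofReal_tsum_of_nonneg (hnn' n) (hsumΦ n)]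
      refine tsum_congr fun m => ?_
      rw [Measure.smul_apply, Measure.dirac_apply' _ measurableSet_Icc, smul_eq_mul,
        add_comm (m : ℝ) (n * β')]
      by_cases hm : (m : ℝ) + n * β ∈ Set.Icc A B
      · rw [Set.indicator_of_mem hm, if_pos hm]
        simp
      · rw [Set.indicator_of_notMem hm, if_neg hm]
        simp
    simp only [h1]
    rw [tsum_eq_sum (s := T) (fun n hn => by rw [hΦT n hn, ENNReal.ofReal_zero]),
      ← ENNReal.ofReal_sum_of_nonneg (fun n _ => hΦ0 n),
      ENNReal.toReal_ofReal (Finset.sum_nonneg fun n _ => hΦ0 n)]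
  rw [hmass]
  have hJT : ∑ n ∈ J, F n = ∑ n ∈ T, if n ∈ J then F n else 0 := by
    rw [← Finset.sum_filter]
    congr 1
    ext n
    simp only [hT, Finset.mem_filter, Finset.mem_union]
    tauto
  rw [hJT, ← Finset.sum_sub_distrib,
    ← Finset.sum_subset (Finset.subset_union_right : S A ∪ S B ⊆ T) (fun n _ hn => by
      rw [hgood n hn, sub_self])]
  calc _ ≤ ∑ n ∈ S A ∪ S B, |Φ n - if n ∈ J then F n else 0| := Finset.abs_sum_le_sum_abs _ _
    _ ≤ ∑ n ∈ S A ∪ S B, R := by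
      refine Finset.sum_le_sum fun n _ => ?_
      have h1 := hΦ0 n
      have h2 := hΦF n
      have h3 : F n ≤ R := hR n
      rw [abs_le]
      split_ifs <;> constructor <;> linarith
    _ = ((S A ∪ S B).card : ℝ) * R := by rw [Finset.sum_const, nsmul_eq_mul]
    _ ≤ _ := by
      gcongr
      calc ((S A ∪ S B).card : ℝ) ≤ (S A).card + (S B).card := by
            exact_mod_cast Finset.card_union_le _ _
        _ ≤ _ := by linarith [hcardS A, hcardS B]

/-- Let `β` be a quadratic irrational with algebraic conjugate `β'`, and let `h` be a
continuous weight function supported on the window `[a,b]`, positive on `(a,b)`, and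
either piecewise linear or twice differentiable with uniformly bounded second
derivative. Then the weighted Dirac comb `ω = ∑_{(m,n) ∈ ℤ²} h(m + nβ')·δ_{m + nβ}` is
bounded distance equivalent to `m₀·λ` with `m₀ = (1/|β − β'|)·∫_a^b h`. -/
theorem weightedCPS_quadratic_bddDist
    (β β' : ℝ) (hirr : Irrational β)
    (hquad : ∃ p q r : ℚ, p ≠ 0 ∧
      (p : ℝ) * β ^ 2 + (q : ℝ) * β + (r : ℝ) = 0 ∧
      (p : ℝ) * β' ^ 2 + (q : ℝ) * β' + (r : ℝ) = 0 ∧ β' ≠ β)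
    (a b : ℝ) (hab : a < b)
    (h : ℝ → ℝ) (hcont : Continuous h)
    (hsupp : ∀ x : ℝ, x ∉ Set.Icc a b → h x = 0)
    (hpos : ∀ x ∈ Set.Ioo a b, 0 < h x)
    (hreg : (∃ (k : ℕ) (t : ℕ → ℝ), 0 < k ∧ t 0 = a ∧ t k = b ∧
        (∀ i < k, t i < t (i + 1)) ∧
        ∀ i < k, ∃ c d : ℝ, ∀ x ∈ Set.Icc (t i) (t (i + 1)), h x = c * x + d) ∨
      (∃ h' h'' : ℝ → ℝ,
        (∀ x ∈ Set.Ioo a b, HasDerivAt h (h' x) x) ∧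
        (∀ x ∈ Set.Ioo a b, HasDerivAt h' (h'' x) x) ∧
        ∃ M : ℝ, ∀ x ∈ Set.Ioo a b, |h'' x| ≤ M))
    (ω : Measure ℝ)
    (hω : ω = Measure.sum (fun g : ℤ × ℤ =>
      ENNReal.ofReal (h ((g.1 : ℝ) + (g.2 : ℝ) * β')) •
        Measure.dirac ((g.1 : ℝ) + (g.2 : ℝ) * β))) :
    BddDistMeasures ω
      (ENNReal.ofReal ((1 / |β - β'|) * ∫ t in a..b, h t) • (volume : Measure ℝ)) := by
  obtain ⟨p, q, r, hp, hβ, hβ', hne⟩ := hquad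
  have hΔ : β - β' ≠ 0 := sub_ne_zero.2 hne.symm
  have hp' : (p : ℝ) ≠ 0 := by exact_mod_cast hp
  have hirr' : Irrational β' := by
    have hvieta : (p : ℝ) * (β + β') + q = 0 := by
      refine (mul_eq_zero.1 ?_).resolve_left hΔ
      linear_combination hβ - hβ'
    have : β' = ((-q / p : ℚ) : ℝ) - β := by
      push_cast
      field_simp
      linear_combination hvieta
    rw [this]
    exact hirr.ratCast_sub _
  have hzero : ∀ x, x ∉ Set.Ioo a b → h x = 0 := by
    have hsub : {x | h x = 0} ⊇ closure (Set.Icc a b)ᶜ :=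
      closure_minimal (fun x hx => hsupp x hx) (isClosed_singleton.preimage hcont)
    intro x hx
    apply hsub
    rw [closure_compl, interior_Icc]
    exact hx
  have hnn : ∀ x, 0 ≤ h x := fun x => by
    by_cases hx : x ∈ Set.Ioo a b
    · exact (hpos x hx).le
    · exact (hzero x hx).ge
  obtain ⟨G, K, hG, hcoh⟩ := exists_bounded_transfer hirr' hp hβ' hab hcont hzero hreg
  set I := ∫ t in a..b, h t with hI
  have hI0 : 0 ≤ I := intervalIntegral.integral_nonneg hab.le fun x _ => hnn x
  obtain ⟨C, hC⟩ := exists_abs_comb_Icc_sub_sum_le hΔ hnn hzero (R := I + 2 * K) (fun n => by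
    rw [hcoh]
    have := abs_le.1 (hG n)
    have := abs_le.1 (hG (n + 1))
    linarith)
  have hK : 0 ≤ K := (abs_nonneg _).trans (hG 0)
  have hC0 : 0 ≤ C := (abs_nonneg _).trans (hC 0 0 le_rfl)
  refine ⟨C + (|I| + 2 * K) + 1, by positivity, fun A B hAB => ?_⟩
  have h1 := hC A B hAB.le
  rw [← hω] at h1
  have h2 := abs_sum_Icc_sub_le_of_transfer hG hcoh
    (min_le_max : min (A / (β - β')) (B / (β - β')) ≤ max (A / (β - β')) (B / (β - β')))
  have h3 : ((ENNReal.ofReal ((1 / |β - β'|) * I) • (volume : Measure ℝ)) (Set.Icc A B)).toReal =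
      I * (max (A / (β - β')) (B / (β - β')) - min (A / (β - β')) (B / (β - β'))) := by
    rw [max_sub_min_eq_abs, Measure.smul_apply, smul_eq_mul, Real.volume_Icc, ENNReal.toReal_mul,
      ENNReal.toReal_ofReal (by positivity), ENNReal.toReal_ofReal (by linarith), ← sub_div, abs_div,
      abs_of_pos (sub_pos.2 hAB)]
    ring
  rw [h3]
  have h4 := abs_sub_le (ω (Set.Icc A B)).toReal _ _ |>.trans (add_le_add h1 h2)
  linarith
end

section
/- Let τ = (1+√5)/2 and let Λ′ = {m + nτ : m, n ∈ ℤ, 0 ≤ m − n/τ < (1+√5)/4} be the Half-Fibonacci cut-and-project set. Then Λ′ is not bounded distance equivalent to any lattice in ℝ: for every a > 0 there is no bijection φ : Λ′ → aℤ with |x − φ(x)| uniformly bounded over x ∈ Λ′. -/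
open Finset in
/-- The number of `j < n` for which the rotation orbit `y - jτ` visits `[0, τ/2)` modulo one. -/
noncomputable def rotationVisits (τ y : ℝ) (n : ℕ) : ℕ :=
  #((range n).filter fun j : ℕ => Int.fract (y - (j : ℝ) * τ) < τ / 2)

theorem rotationVisits_add (τ y : ℝ) (p : ℤ) (q n : ℕ) :
    rotationVisits τ y (q + n) =
      rotationVisits τ y q + rotationVisits τ (y + (p - q * τ)) n := by
  have h : ∀ j : ℕ, Int.fract (y + ((p : ℝ) - q * τ) - j * τ) =
      Int.fract (y - ((q + j : ℕ) : ℝ) * τ) := by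
    intro j
    rw [← Int.fract_add_intCast (y - ((q + j : ℕ) : ℝ) * τ) p]
    congr 1
    push_cast
    ring
  simp only [rotationVisits, h, Finset.card_filter, Finset.sum_range_add]

open Finset in
/-- Along one period of a good rational approximation `p / q` of `τ` with odd numerator, the number
of visits to `[0, τ/2)` is `qτ/2` rounded up. -/
theorem rotationVisits_of_approx {τ y ε : ℝ} {q h : ℕ} (hcop : Nat.Coprime (2 * h + 1) q)
    (hhq : h < q) (hε : ε = (2 * h + 1 : ℕ) - q * τ) (hε0 : 0 ≤ ε) (hy : 0 ≤ y)
    (hsmall : q * ε + q * y + ε / 2 < 1 / 2) : rotationVisits τ y q = h + 1 := by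
  have hq : 0 < q := by omega
  have hqR : (0 : ℝ) < q := by exact_mod_cast hq
  have hqZ : (0 : ℤ) < q := by exact_mod_cast hq
  set r : ℕ → ℤ := fun j => (-((j : ℤ) * (2 * h + 1))) % q
  have hr0 : ∀ j, 0 ≤ r j := fun j => Int.emod_nonneg _ hqZ.ne'
  have hrq : ∀ j, r j < q := fun j => Int.emod_lt_of_pos _ hqZ
  have hinj : Set.InjOn (fun j => (r j).toNat) (range q : Finset ℕ) := by
    intro i hi j hj hij
    have hi' : i < q := by simpa using hi
    have hj' : j < q := by simpa using hj
    have hij' : r i = r j := by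
      have := hr0 i
      have := hr0 j
      simp only at hij
      omega
    have hmod : (-((i : ℤ) * (2 * h + 1))) ≡ (-((j : ℤ) * (2 * h + 1))) [ZMOD q] := hij'
    have hmod' : (2 * h + 1) * i ≡ (2 * h + 1) * j [MOD q] := by
      rw [← Int.natCast_modEq_iff]
      have := hmod.neg
      push_cast
      simpa [mul_comm] using this
    have := Nat.ModEq.cancel_left_of_coprime (Nat.coprime_comm.mp hcop) hmod'
    exact Nat.ModEq.eq_of_lt_of_lt this hi' hj'
  have himage : (range q).image (fun j => (r j).toNat) = range q := by
    apply Finset.eq_of_subset_of_card_le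
    · intro k hk
      obtain ⟨j, -, rfl⟩ := Finset.mem_image.mp hk
      have := hr0 j
      have := hrq j
      simp only [Finset.mem_range]
      omega
    · rw [Finset.card_image_of_injOn hinj]
  have hiff : ∀ j ∈ range q, (Int.fract (y - (j : ℝ) * τ) < τ / 2 ↔ (r j).toNat < h + 1) := by
    intro j hj
    have hjq : (j : ℝ) ≤ q := by exact_mod_cast (Finset.mem_range.mp hj).le
    have hδ0 : 0 ≤ j * ε + q * y := by positivity
    have hδ : j * ε + q * y < 1 / 2 - ε / 2 := by
      nlinarith [mul_le_mul_of_nonneg_right hjq hε0]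
    have hdiv : (q : ℤ) * ((-((j : ℤ) * (2 * h + 1))) / q) + r j = -((j : ℤ) * (2 * h + 1)) :=
      Int.mul_ediv_add_emod _ _
    have hdivR : (q : ℝ) * (((-((j : ℤ) * (2 * h + 1))) / q : ℤ) : ℝ) + r j =
        -((j : ℝ) * (2 * h + 1)) := by exact_mod_cast hdiv
    set z : ℤ := (-((j : ℤ) * (2 * h + 1))) / q
    have hrqR : (r j : ℝ) + 1 ≤ q := by exact_mod_cast hrq j
    have hr0R : (0 : ℝ) ≤ r j := by exact_mod_cast hr0 j
    have hfr : Int.fract (y - (j : ℝ) * τ) = (r j + (j * ε + q * y)) / q := by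
      rw [Int.fract_eq_iff]
      refine ⟨by positivity, ?_, z, ?_⟩
      · rw [div_lt_one hqR]
        linarith
      · rw [sub_eq_iff_eq_add, ← sub_eq_iff_eq_add', eq_div_iff hqR.ne', hε]
        push_cast
        linear_combination -hdivR
    have hqτ : τ / 2 * q = h + 1 / 2 - ε / 2 := by
      rw [hε]
      push_cast
      ring
    rw [hfr, div_lt_iff₀ hqR, hqτ]
    constructor
    · intro hlt
      have : (r j : ℝ) < ((h + 1 : ℤ) : ℝ) := by
        push_cast
        linarith
      have : r j < h + 1 := by exact_mod_cast this
      omega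
    · intro hlt
      have : r j ≤ h := by omega
      have : (r j : ℝ) ≤ h := by exact_mod_cast this
      linarith
  calc rotationVisits τ y q = #{j ∈ range q | (r j).toNat < h + 1} := by
        rw [rotationVisits, Finset.filter_congr hiff]
    _ = #({k ∈ (range q).image (fun j => (r j).toNat) | k < h + 1}) := by
        rw [Finset.filter_image, Finset.card_image_of_injOn]
        exact hinj.mono (Finset.coe_subset.mpr (Finset.filter_subset _ _))
    _ = #(range (h + 1)) := by
        rw [himage]
        congr 1
        ext k
        simp only [Finset.mem_filter, Finset.mem_range]
        omega
    _ = h + 1 := Finset.card_range _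

open Real in
theorem fib_mul_goldenConj_pow_le {k : ℕ} (hk : Even k) :
    (Nat.fib k : ℝ) * goldenConj ^ k ≤ 0.448 := by
  have h5 : (2.236 : ℝ) < √5 := by
    rw [Real.lt_sqrt (by norm_num)]
    norm_num
  have hprod : goldenRatio ^ k * goldenConj ^ k = 1 := by
    rw [← mul_pow, goldenRatio_mul_goldenConj, hk.neg_one_pow]
  rw [coe_fib_eq, div_mul_eq_mul_div, div_le_iff₀ (by positivity)]
  nlinarith [sq_nonneg (goldenConj ^ k)]

open Real in
theorem goldenConj_pow_twelve_le : goldenConj ^ 12 ≤ 1 / 300 := by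
  have h : goldenConj ^ 2 = goldenConj + 1 := goldenConj_sq
  have h5 : (2.236 : ℝ) < √5 := by
    rw [Real.lt_sqrt (by norm_num)]
    norm_num
  have h5' : √5 < 2.237 := by
    rw [Real.sqrt_lt' (by norm_num)]
    norm_num
  have hlo : -0.6185 ≤ goldenConj := by
    rw [goldenConj]
    linarith
  have hhi : goldenConj ≤ -0.618 := by
    rw [goldenConj]
    linarith
  have h2 : goldenConj ^ 2 ≤ 0.383 := by nlinarith
  calc goldenConj ^ 12 = (goldenConj ^ 2) ^ 6 := by ring
    _ ≤ 0.383 ^ 6 := by gcongr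
    _ ≤ 1 / 300 := by norm_num

open Real in
/-- A block of length `q = fib (12i)` has at least `qτ/2 + 1/2` visits. -/
theorem rotationVisits_fib {i : ℕ} (hi : 0 < i) {y : ℝ} (hy : 0 ≤ y)
    (hy' : y ≤ goldenConj ^ (12 * i) / 20) :
    (rotationVisits goldenRatio y (Nat.fib (12 * i)) : ℝ) =
      Nat.fib (12 * i) * (goldenRatio / 2) + goldenConj ^ (12 * i) / 2 + 1 / 2 := by
  have hcop : Nat.Coprime (Nat.fib (12 * i + 1)) (Nat.fib (12 * i)) :=
    (Nat.fib_coprime_fib_succ _).symm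
  have heven : 2 ∣ Nat.fib (12 * i) := Nat.fib_dvd 3 (12 * i) ⟨4 * i, by ring⟩
  have hodd : Odd (Nat.fib (12 * i + 1)) := by
    rw [← Nat.not_even_iff_odd, even_iff_two_dvd]
    intro h
    simpa using Nat.eq_one_of_dvd_coprimes hcop h heven
  obtain ⟨h, hh⟩ := hodd
  have hε := fib_succ_sub_goldenRatio_mul_fib (12 * i)
  have hpow : goldenConj ^ (12 * i) ≤ 1 / 300 := by
    rw [pow_mul]
    calc (goldenConj ^ 12) ^ i ≤ (goldenConj ^ 12) ^ 1 :=
          pow_le_pow_of_le_one (by positivity)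
            (goldenConj_pow_twelve_le.trans (by norm_num)) hi
      _ ≤ 1 / 300 := by simpa using goldenConj_pow_twelve_le
  have hev : Even (12 * i) := ⟨6 * i, by ring⟩
  have hpos : 0 ≤ goldenConj ^ (12 * i) := hev.pow_nonneg _
  have hmul := fib_mul_goldenConj_pow_le hev
  have hfib : Nat.fib (12 * i + 1) ≤ Nat.fib (12 * i) + Nat.fib (12 * i) := by
    obtain ⟨m, hm⟩ : ∃ m, 12 * i = m + 1 := ⟨12 * i - 1, by omega⟩
    rw [hm, Nat.fib_add_two, add_comm]
    have := Nat.fib_le_fib_succ (n := m)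
    omega
  rw [hh] at hcop hε hfib
  have key : rotationVisits goldenRatio y (Nat.fib (12 * i)) = h + 1 := by
    refine rotationVisits_of_approx (ε := goldenConj ^ (12 * i)) hcop (by omega) ?_ hpos hy ?_
    · rw [← hε]
      ring
    · have := mul_le_mul_of_nonneg_left hy' (Nat.cast_nonneg (α := ℝ) (Nat.fib (12 * i)))
      linarith
  rw [key]
  push_cast at hε ⊢
  linear_combination hε / 2

open Real in
/-- The excess of visits over `nτ/2` is unbounded. -/
theorem exists_rotationVisits_ge (J : ℕ) : ∃ n : ℕ, ∀ y : ℝ, 0 ≤ y →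
    y ≤ goldenConj ^ (12 * J) / 20 →
      (n : ℝ) * (goldenRatio / 2) + J / 2 ≤ rotationVisits goldenRatio y n := by
  induction J with
  | zero => exact ⟨0, fun y _ _ => by simp⟩
  | succ J ih =>
    obtain ⟨n, hn⟩ := ih
    refine ⟨Nat.fib (12 * (J + 1)) + n, fun y hy hy' => ?_⟩
    have hpos : 0 ≤ goldenConj ^ (12 * (J + 1)) := Even.pow_nonneg ⟨6 * (J + 1), by ring⟩ _
    have hpos' : 0 ≤ goldenConj ^ (12 * J) := Even.pow_nonneg ⟨6 * J, by ring⟩ _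
    have hstep : goldenConj ^ (12 * (J + 1)) ≤ goldenConj ^ (12 * J) * (1 / 300) := by
      rw [mul_add, pow_add, mul_one]
      exact mul_le_mul_of_nonneg_left goldenConj_pow_twelve_le hpos'
    have hε := fib_succ_sub_goldenRatio_mul_fib (12 * (J + 1))
    have h1 := rotationVisits_fib (i := J + 1) J.succ_pos hy hy'
    have hshift : y + (((Nat.fib (12 * (J + 1) + 1) : ℤ) : ℝ) -
        Nat.fib (12 * (J + 1)) * goldenRatio) = y + goldenConj ^ (12 * (J + 1)) := by
      rw [← hε]
      push_cast
      ring
    have h2 := hn (y + goldenConj ^ (12 * (J + 1))) (by positivity) (by linarith)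
    rw [rotationVisits_add _ _ (Nat.fib (12 * (J + 1) + 1) : ℤ), hshift]
    push_cast at h1 ⊢
    linarith

theorem card_le_of_injOn_int {ι : Type*} {s : Finset ι} {f : ι → ℤ} (hf : Set.InjOn f s)
    {l u : ℝ} (hlu : l ≤ u) (hl : ∀ i ∈ s, l ≤ f i) (hu : ∀ i ∈ s, (f i : ℝ) ≤ u) :
    (s.card : ℝ) ≤ u - l + 1 := by
  have h : s.card ≤ (Finset.Icc ⌈l⌉ ⌊u⌋).card :=
    Finset.card_le_card_of_injOn f
      (fun i hi => by simpa using ⟨Int.ceil_le.mpr (hl i hi), Int.le_floor.mpr (hu i hi)⟩) hf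
  rw [Int.card_Icc] at h
  have h3 : ((s.card : ℕ) : ℤ) ≤ max (⌊u⌋ + 1 - ⌈l⌉) 0 := by omega
  have h4 : (s.card : ℝ) ≤ max ((⌊u⌋ : ℝ) + 1 - ⌈l⌉) 0 := by exact_mod_cast h3
  refine h4.trans (max_le ?_ (by linarith))
  linarith [Int.floor_le u, Int.le_ceil l]

theorem le_card_of_forall_exists_int {ι : Type*} {s : Finset ι} {f : ι → ℤ} {l u : ℝ}
    (h : ∀ k : ℤ, l ≤ k → (k : ℝ) ≤ u → ∃ i ∈ s, f i = k) : u - l - 1 ≤ s.card := by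
  classical
  have hsub : Finset.Icc ⌈l⌉ ⌊u⌋ ⊆ s.image f := by
    intro k hk
    rw [Finset.mem_Icc] at hk
    exact Finset.mem_image.mpr (h k (Int.ceil_le.mp hk.1) (Int.le_floor.mp hk.2))
  have h1 := (Finset.card_le_card hsub).trans Finset.card_image_le
  rw [Int.card_Icc] at h1
  have h3 : ⌊u⌋ + 1 - ⌈l⌉ ≤ (s.card : ℤ) := by omega
  have h4 : (⌊u⌋ : ℝ) + 1 - ⌈l⌉ ≤ s.card := by exact_mod_cast h3
  linarith [Int.lt_floor_add_one u, Int.ceil_lt_add_one l]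

open Real in
/-- The elements of the Half-Fibonacci set, indexed by the visits of a rotation. -/
theorem mem_halfFibonacci_iff (x : ℝ) :
    (∃ m n : ℤ, x = (m : ℝ) + (n : ℝ) * goldenRatio ∧ 0 ≤ (m : ℝ) - (n : ℝ) / goldenRatio ∧
      (m : ℝ) - (n : ℝ) / goldenRatio < (1 + √5) / 4) ↔
    ∃ j : ℤ, Int.fract (0 - (j : ℝ) * goldenRatio) < goldenRatio / 2 ∧
      x = j * √5 + Int.fract (0 - (j : ℝ) * goldenRatio) := by
  have hdiv : ∀ n : ℝ, n / goldenRatio = n * goldenRatio - n := by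
    intro n
    rw [div_eq_iff goldenRatio_ne_zero]
    linear_combination (-n) * goldenRatio_sq
  have hτ : (1 + √5) / 4 = goldenRatio / 2 := by
    rw [goldenRatio]
    ring
  have h5 : √5 = 2 * goldenRatio - 1 := by
    rw [goldenRatio]
    ring
  have hlt : goldenRatio / 2 < 1 := by linarith [goldenRatio_lt_two]
  simp only [hdiv, hτ]
  rw [h5]
  constructor
  · rintro ⟨m, n, rfl, h0, h1⟩
    have hfr : Int.fract (0 - (n : ℝ) * goldenRatio) = m - (n * goldenRatio - n) := by
      rw [Int.fract_eq_iff]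
      refine ⟨h0, h1.trans hlt, -m - n, ?_⟩
      push_cast
      ring
    refine ⟨n, by rwa [hfr], ?_⟩
    rw [hfr]
    ring
  · rintro ⟨j, hj, rfl⟩
    have hfr : ((-j - ⌊0 - (j : ℝ) * goldenRatio⌋ : ℤ) : ℝ) - (j * goldenRatio - j) =
        Int.fract (0 - (j : ℝ) * goldenRatio) := by
      rw [Int.fract]
      push_cast
      ring
    refine ⟨-j - ⌊0 - (j : ℝ) * goldenRatio⌋, j, ?_, ?_, ?_⟩
    · rw [← hfr]
      ring
    · rw [hfr]
      exact Int.fract_nonneg _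
    · rwa [hfr]

open Real in
/-- Bounded distance to `aℤ` forces the visits of the rotation to have bounded discrepancy. -/
theorem exists_abs_rotationVisits_sub_le {Λ : Set ℝ}
    (hΛ : ∀ x, x ∈ Λ ↔ ∃ j : ℤ, Int.fract (0 - (j : ℝ) * goldenRatio) < goldenRatio / 2 ∧
      x = j * √5 + Int.fract (0 - (j : ℝ) * goldenRatio))
    {a : ℝ} (ha : 0 < a) {φ : ℝ → ℝ} (hφ : Set.BijOn φ Λ {y : ℝ | ∃ k : ℤ, y = a * (k : ℝ)})
    {C : ℝ} (hC : ∀ x ∈ Λ, |x - φ x| ≤ C) :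
    ∃ K : ℝ, ∀ n : ℕ, |(rotationVisits goldenRatio 0 n : ℝ) - n * (√5 / a)| ≤ K := by
  set g : ℤ → ℝ := fun j => j * √5 + Int.fract (0 - (j : ℝ) * goldenRatio) with hg
  set D : ℝ := |C| + 1
  have hD : 0 < D := by positivity
  have h5 : 0 < √5 := by positivity
  have hnear : ∀ j : ℤ, g j ∈ Λ → |φ (g j) - j * √5| ≤ D := by
    intro j hj
    have h1 := abs_le.mp ((hC _ hj).trans (le_abs_self C))
    have h2 := Int.fract_nonneg (0 - (j : ℝ) * goldenRatio)
    have h3 := Int.fract_lt_one (0 - (j : ℝ) * goldenRatio)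
    have h4 : g j = j * √5 + Int.fract (0 - (j : ℝ) * goldenRatio) := rfl
    rw [abs_le]
    constructor <;> simp only [D] <;> linarith
  have hginj : Function.Injective g := by
    intro i j hij
    have h5' : (1 : ℝ) < √5 := by
      rw [Real.lt_sqrt (by norm_num)]
      norm_num
    have key : ∀ i j : ℤ, i < j → g i < g j := by
      intro i j h
      have h' : (i : ℝ) + 1 ≤ j := by exact_mod_cast h
      have h2 := Int.fract_nonneg (0 - (j : ℝ) * goldenRatio)
      have h3 := Int.fract_lt_one (0 - (i : ℝ) * goldenRatio)
      simp only [hg]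
      nlinarith
    exact StrictMono.injective (fun i j h => key i j h) hij
  set s : ℕ → Finset ℕ := fun n =>
    {j ∈ Finset.range n | Int.fract (0 - (j : ℝ) * goldenRatio) < goldenRatio / 2} with hs
  have hmem : ∀ j : ℕ, Int.fract (0 - (j : ℝ) * goldenRatio) < goldenRatio / 2 → g j ∈ Λ :=
    fun j hj => (hΛ _).mpr ⟨j, by simpa using hj, rfl⟩
  set f : ℕ → ℤ := fun j => round (φ (g j) / a) with hf
  have hfφ : ∀ j : ℕ, g j ∈ Λ → φ (g j) = a * f j := by
    intro j hj
    obtain ⟨k, hk⟩ := hφ.mapsTo hj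
    simp only [hf]
    rw [hk, mul_div_cancel_left₀ _ ha.ne', round_intCast]
  refine ⟨2 * D / a + 1 + √5 / a, fun n => ?_⟩
  have hupper : ((s n).card : ℝ) ≤ (n * √5 + D) / a - (-D / a) + 1 := by
    refine card_le_of_injOn_int (f := f) ?_ ?_ ?_ ?_
    · intro i hi j hj hij
      have hi' := hmem i (Finset.mem_filter.mp hi).2
      have hj' := hmem j (Finset.mem_filter.mp hj).2
      have := hφ.injOn hi' hj' (by rw [hfφ i hi', hfφ j hj', hij])
      exact_mod_cast hginj this
    · gcongr
      have : 0 ≤ n * √5 := by positivity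
      linarith
    · intro j hj
      have hj' := hmem j (Finset.mem_filter.mp hj).2
      have h1 := abs_le.mp (hnear j hj')
      rw [hfφ j hj'] at h1
      have : 0 ≤ ((j : ℤ) : ℝ) * √5 := by positivity
      rw [div_le_iff₀ ha]
      linarith
    · intro j hj
      have hj' := hmem j (Finset.mem_filter.mp hj).2
      have h1 := abs_le.mp (hnear j hj')
      rw [hfφ j hj'] at h1
      have hjn : ((j : ℤ) : ℝ) ≤ n := by
        exact_mod_cast (Finset.mem_range.mp (Finset.mem_filter.mp hj).1).le
      have := mul_le_mul_of_nonneg_right hjn h5.le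
      rw [le_div_iff₀ ha]
      linarith
  have hlower : (n * √5 - √5 - D) / a - D / a - 1 ≤ ((s n).card : ℝ) := by
    refine le_card_of_forall_exists_int (f := f) ?_
    intro k hk1 hk2
    rw [div_le_iff₀ ha] at hk1
    rw [le_div_iff₀ ha] at hk2
    obtain ⟨x, hx, hxk⟩ := hφ.surjOn ⟨k, rfl⟩
    obtain ⟨j, hj, rfl⟩ := (hΛ x).mp hx
    have h1 := abs_le.mp (hnear j hx)
    rw [show φ (g j) = a * k from hxk] at h1
    have hj0 : 0 ≤ j := by
      have : 0 ≤ (j : ℝ) * √5 := by linarith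
      exact_mod_cast nonneg_of_mul_nonneg_left this h5
    have hjn : j < n := by
      have : (j : ℝ) * √5 ≤ (n - 1) * √5 := by linarith
      have : (j : ℝ) ≤ n - 1 := le_of_mul_le_mul_right this h5
      have : (j : ℝ) < n := by linarith
      exact_mod_cast this
    lift j to ℕ using hj0
    refine ⟨j, ?_, ?_⟩
    · simp only [hs, Finset.mem_filter, Finset.mem_range]
      exact ⟨by exact_mod_cast hjn, by simpa using hj⟩
    · have h2 := hfφ j hx
      rw [show φ (g j) = a * k from hxk] at h2
      exact_mod_cast (mul_left_cancel₀ ha.ne' h2).symm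
  have hcard : (rotationVisits goldenRatio 0 n : ℝ) = (s n).card := rfl
  have e1 : (n * √5 + D) / a - (-D / a) + 1 = n * (√5 / a) + (2 * D / a + 1) := by ring
  have e2 : (n * √5 - √5 - D) / a - D / a - 1 =
      n * (√5 / a) - (2 * D / a + 1 + √5 / a) := by ring
  rw [e1] at hupper
  rw [e2] at hlower
  have : 0 < √5 / a := by positivity
  rw [hcard, abs_le]
  constructor <;> linarith

open Real in
theorem rotationVisits_discrepancy_unbounded (c K : ℝ)
    (h : ∀ n : ℕ, |(rotationVisits goldenRatio 0 n : ℝ) - n * c| ≤ K) : False := by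
  have hc : c ≤ goldenRatio / 2 := by
    by_contra! hlt
    obtain ⟨i, hi⟩ := exists_nat_gt ((K + 1) / (c - goldenRatio / 2))
    rw [div_lt_iff₀ (by linarith)] at hi
    have hpos : 0 ≤ goldenConj ^ (12 * (i + 1)) := Even.pow_nonneg ⟨6 * (i + 1), by ring⟩ _
    have hle : goldenConj ^ (12 * (i + 1)) ≤ 1 := by
      rw [pow_mul]
      exact pow_le_one₀ (by positivity) (goldenConj_pow_twelve_le.trans (by norm_num))
    have h1 := rotationVisits_fib (i := i + 1) i.succ_pos le_rfl (by positivity)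
    have h2 := (abs_le.mp (h (Nat.fib (12 * (i + 1))))).1
    have h3 : i ≤ Nat.fib (12 * (i + 1)) := by
      have := Nat.le_fib_self (n := 12 * (i + 1)) (by omega)
      omega
    have h3' : (i : ℝ) ≤ Nat.fib (12 * (i + 1)) := by exact_mod_cast h3
    have h4 := mul_le_mul_of_nonneg_right h3' (sub_pos.mpr hlt).le
    rw [h1] at h2
    linarith
  obtain ⟨J, hJ⟩ := exists_nat_gt (2 * K)
  obtain ⟨n, hn⟩ := exists_rotationVisits_ge J
  have hpos : 0 ≤ goldenConj ^ (12 * J) := Even.pow_nonneg ⟨6 * J, by ring⟩ _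
  have h1 := hn 0 le_rfl (by positivity)
  have h2 := (abs_le.mp (h n)).2
  have h3 := mul_le_mul_of_nonneg_left hc (Nat.cast_nonneg (α := ℝ) n)
  linarith

/-- The Half-Fibonacci cut-and-project set
`Λ′ = {m + nτ : m, n ∈ ℤ, 0 ≤ m − n/τ < (1+√5)/4}`, `τ = (1+√5)/2`, is not bounded
distance equivalent to any lattice `aℤ` in `ℝ`. -/
theorem halfFibonacci_not_bddDist_lattice (τ : ℝ) (hτ : τ = (1 + Real.sqrt 5) / 2)
    (Λ' : Set ℝ)
    (hΛ' : Λ' = {x : ℝ | ∃ m n : ℤ, x = (m : ℝ) + (n : ℝ) * τ ∧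
      0 ≤ (m : ℝ) - (n : ℝ) / τ ∧ (m : ℝ) - (n : ℝ) / τ < (1 + Real.sqrt 5) / 4}) :
    ∀ a : ℝ, 0 < a →
      ¬ ∃ φ : ℝ → ℝ,
        Set.BijOn φ Λ' {y : ℝ | ∃ k : ℤ, y = a * (k : ℝ)} ∧
        ∃ C : ℝ, ∀ x ∈ Λ', |x - φ x| ≤ C := by
  rintro a ha ⟨φ, hφ, C, hC⟩
  obtain rfl : τ = Real.goldenRatio := hτ
  have hΛ := fun x => (Set.ext_iff.mp hΛ' x).trans (mem_halfFibonacci_iff x)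
  obtain ⟨K, hK⟩ := exists_abs_rotationVisits_sub_le hΛ ha hφ hC
  exact rotationVisits_discrepancy_unbounded _ K hK
end
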